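/- arXiv:1510.07284 — 2 statements merged into one kernel-verified Lean document; each statement's English description precedes it below -/
import Mathlib

section
/- Let X be a standard Gaussian vector in ℝⁿ and 1 ≤ p ≤ 2. Then there exist absolute constants c, C > 0 such that for all r ≥ 1, c·√(r/n)·E‖X‖_p ≤ (E|‖X‖_p − E‖X‖_p|^r)^{1/r} ≤ C·√(r/n)·E‖X‖_p. -/
open MeasureTheory ProbabilityTheory

/-- The standard Gaussian measure on `Fin n → ℝ`. -/
noncomputable abbrev stdGauss (n : ℕ) : Measure (Fin n → ℝ) :=
  Measure.pi fun _ : Fin n => gaussianReal 0 1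

lemma stdGauss_eq_withDensity (n : ℕ) :
    stdGauss n = (volume : Measure (Fin n → ℝ)).withDensity
      (fun x => ENNReal.ofReal (∏ i, gaussianPDFReal 0 1 (x i))) := by
  refine Measure.pi_eq fun s hs => ?_
  have hint : ∀ i, Integrable ((s i).indicator (gaussianPDFReal 0 1)) :=
    fun i => (integrable_gaussianPDFReal 0 1).indicator (hs i)
  rw [withDensity_apply _ (MeasurableSet.univ_pi hs), ← lintegral_indicator (MeasurableSet.univ_pi hs)]
  have h1 : ∀ x : Fin n → ℝ, (Set.univ.pi s).indicator
      (fun x => ENNReal.ofReal (∏ i, gaussianPDFReal 0 1 (x i))) x =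
      ENNReal.ofReal (∏ i, (s i).indicator (gaussianPDFReal 0 1) (x i)) := by
    intro x
    by_cases hx : x ∈ Set.univ.pi s
    · rw [Set.indicator_of_mem hx]
      congr 1
      refine Finset.prod_congr rfl fun i _ => ?_
      rw [Set.indicator_of_mem (hx i (Set.mem_univ i))]
    · rw [Set.indicator_of_notMem hx]
      simp only [Set.mem_univ_pi, not_forall] at hx
      obtain ⟨i, hi⟩ := hx
      rw [Finset.prod_eq_zero (Finset.mem_univ i) (Set.indicator_of_notMem hi _)]
      simp
  have hnn : ∀ i (y : ℝ), 0 ≤ (s i).indicator (gaussianPDFReal 0 1) y :=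
    fun i y => Set.indicator_nonneg (fun z _ => gaussianPDFReal_nonneg 0 1 z) y
  simp_rw [h1]
  have hprod : Integrable
      (fun x : Fin n → ℝ => ∏ i, (s i).indicator (gaussianPDFReal 0 1) (x i)) volume :=
    Integrable.fintype_prod hint
  rw [← ofReal_integral_eq_lintegral_ofReal hprod
      (ae_of_all _ fun x => Finset.prod_nonneg fun i _ => hnn i _),
    integral_fintype_prod_volume_eq_prod, ENNReal.ofReal_prod_of_nonneg
      (fun i _ => integral_nonneg (hnn i))]
  refine Finset.prod_congr rfl fun i _ => ?_
  rw [gaussianReal_apply_eq_integral 0 one_ne_zero, integral_indicator (hs i)]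

lemma integral_stdGauss (n : ℕ) (g : (Fin n → ℝ) → ℝ) :
    ∫ x, g x ∂stdGauss n = ∫ x, (∏ i, gaussianPDFReal 0 1 (x i)) * g x := by
  rw [stdGauss_eq_withDensity, integral_withDensity_eq_integral_toReal_smul]
  · refine integral_congr_ae (ae_of_all _ fun x => ?_)
    simp only [smul_eq_mul]
    rw [ENNReal.toReal_ofReal (Finset.prod_nonneg fun i _ => gaussianPDFReal_nonneg 0 1 _)]
  · refine ENNReal.measurable_ofReal.comp ?_
    exact Finset.measurable_prod _ fun i _ =>
      (measurable_gaussianPDFReal 0 1).comp (measurable_pi_apply i)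
  · exact ae_of_all _ fun _ => ENNReal.ofReal_lt_top

/-- Scaling change of variables for the standard Gaussian measure. -/
lemma integral_stdGauss_eq_scale (n : ℕ) {s : ℝ} (hs : 0 < s) (g : (Fin n → ℝ) → ℝ) :
    ∫ x, g x ∂stdGauss n =
      ∫ x, s ^ n * Real.exp (-((s ^ 2 - 1) / 2 * ∑ i, x i ^ 2)) * g (s • x) ∂stdGauss n := by
  rw [integral_stdGauss, integral_stdGauss]
  have h := Measure.integral_comp_smul_of_nonneg (volume : Measure (Fin n → ℝ))
    (fun x => (∏ i, gaussianPDFReal 0 1 (x i)) * g x) s (hR := hs.le)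
  rw [Module.finrank_fin_fun, smul_eq_mul] at h
  have h2 : ∫ x : Fin n → ℝ, (∏ i, gaussianPDFReal 0 1 (x i)) * g x =
      s ^ n * ∫ x : Fin n → ℝ, (∏ i, gaussianPDFReal 0 1 ((s • x) i)) * g (s • x) := by
    rw [h]; field_simp
  rw [h2, ← integral_const_mul]
  refine integral_congr_ae (ae_of_all _ fun x => ?_)
  have : ∏ i, gaussianPDFReal 0 1 ((s • x) i) =
      (∏ i, gaussianPDFReal 0 1 (x i)) * Real.exp (-((s ^ 2 - 1) / 2 * ∑ i, x i ^ 2)) := by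
    rw [Finset.mul_sum, ← Finset.sum_neg_distrib, Real.exp_sum, ← Finset.prod_mul_distrib]
    refine Finset.prod_congr rfl fun i _ => ?_
    simp only [gaussianPDFReal, Pi.smul_apply, smul_eq_mul, mul_assoc, ← Real.exp_add]
    congr 3
    simp
    ring
  simp only [this]
  ring

lemma gaussianPDFReal_mul_exp_sq (t x : ℝ) :
    gaussianPDFReal 0 1 x * Real.exp (t * x ^ 2) =
      (√(2 * Real.pi))⁻¹ * Real.exp (-(1 / 2 - t) * x ^ 2) := by
  simp only [gaussianPDFReal, mul_assoc, ← Real.exp_add, NNReal.coe_one, mul_one]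
  congr 2
  ring

lemma integrable_exp_mul_sq_gaussianReal {t : ℝ} (ht : t < 1 / 2) :
    Integrable (fun x => Real.exp (t * x ^ 2)) (gaussianReal 0 1) := by
  rw [gaussianReal_of_var_ne_zero _ one_ne_zero,
    integrable_withDensity_iff_integrable_smul' (measurable_gaussianPDF _ _)
      (ae_of_all _ fun _ => gaussianPDF_lt_top)]
  simp only [toReal_gaussianPDF, smul_eq_mul, gaussianPDFReal_mul_exp_sq]
  exact (integrable_exp_neg_mul_sq (by linarith)).const_mul _

lemma integral_exp_mul_sq_gaussianReal {t : ℝ} (ht : t < 1 / 2) :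
    ∫ x, Real.exp (t * x ^ 2) ∂gaussianReal 0 1 = (√(1 - 2 * t))⁻¹ := by
  rw [integral_gaussianReal_eq_integral_smul one_ne_zero]
  simp only [smul_eq_mul, gaussianPDFReal_mul_exp_sq]
  rw [integral_const_mul, integral_gaussian, ← Real.sqrt_inv, ← Real.sqrt_inv,
    ← Real.sqrt_mul (by positivity)]
  congr 1
  have h1 : 1 - 2 * t ≠ 0 := by linarith
  have h2 : 1 / 2 - t ≠ 0 := by linarith
  field_simp

lemma integrable_exp_sum_sq_stdGauss (n : ℕ) {t : ℝ} (ht : t < 1 / 2) :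
    Integrable (fun x => Real.exp (t * ∑ i, x i ^ 2)) (stdGauss n) := by
  simp only [Finset.mul_sum, Real.exp_sum]
  exact Integrable.fintype_prod fun _ => integrable_exp_mul_sq_gaussianReal ht

lemma integral_exp_sum_sq_stdGauss (n : ℕ) {t : ℝ} (ht : t < 1 / 2) :
    ∫ x, Real.exp (t * ∑ i, x i ^ 2) ∂stdGauss n = (√(1 - 2 * t))⁻¹ ^ n := by
  simp only [Finset.mul_sum, Real.exp_sum]
  rw [integral_fintype_prod_eq_pow (fun y : ℝ => Real.exp (t * y ^ 2)),
    integral_exp_mul_sq_gaussianReal ht, Fintype.card_fin]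

/-- The `ℓ_p` norm on `Fin n → ℝ`, as an explicit formula. -/
noncomputable abbrev lpNm {n : ℕ} (p : ℝ) (x : Fin n → ℝ) : ℝ := (∑ i, |x i| ^ p) ^ (1 / p)

section deterministic

variable {n : ℕ} {p : ℝ}

lemma lpNm_nonneg (x : Fin n → ℝ) : 0 ≤ lpNm p x := by positivity

lemma continuous_lpNm (hp : 1 ≤ p) : Continuous (lpNm p : (Fin n → ℝ) → ℝ) := by
  refine Continuous.rpow_const ?_ fun _ => Or.inr (by positivity)
  exact continuous_finsetSum _ fun i _ =>
    (continuous_apply i).abs.rpow_const fun _ => Or.inr (by linarith)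

lemma lpNm_smul (hp : 1 ≤ p) {s : ℝ} (hs : 0 ≤ s) (x : Fin n → ℝ) :
    lpNm p (s • x) = s * lpNm p x := by
  have h : ∑ i, |(s • x) i| ^ p = s ^ p * ∑ i, |x i| ^ p := by
    rw [Finset.mul_sum]
    refine Finset.sum_congr rfl fun i _ => ?_
    rw [Pi.smul_apply, smul_eq_mul, abs_mul, abs_of_nonneg hs,
      Real.mul_rpow hs (abs_nonneg _)]
  rw [lpNm, h, Real.mul_rpow (by positivity) (by positivity), ← Real.rpow_mul hs,
    mul_one_div_cancel (by linarith), Real.rpow_one]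

lemma lpNm_le (hn : 0 < n) (hp : 1 ≤ p) (hp2 : p ≤ 2) (x : Fin n → ℝ) :
    lpNm p x ≤ (n : ℝ) ^ (1 / p - 1 / 2) * √(∑ i, x i ^ 2) := by
  have hn' : (0 : ℝ) < n := by exact_mod_cast hn
  have hp0 : 0 < p := by linarith
  have h := Real.rpow_sum_le_const_mul_sum_rpow_of_nonneg (s := Finset.univ)
    (f := fun i => |x i| ^ p) (p := 2 / p) (by rw [le_div_iff₀ hp0]; linarith)
    (fun i _ => by positivity)
  have h1 : ∀ i, (|x i| ^ p) ^ (2 / p) = x i ^ 2 := by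
    intro i
    rw [← Real.rpow_mul (abs_nonneg _), mul_div_cancel₀ _ hp0.ne', Real.rpow_two, sq_abs]
  simp only [h1, Finset.card_univ, Fintype.card_fin] at h
  have h2 := Real.rpow_le_rpow (by positivity) h (show (0 : ℝ) ≤ 1 / 2 by norm_num)
  rw [Real.mul_rpow (by positivity) (by positivity), ← Real.rpow_mul (by positivity),
    ← Real.rpow_mul (by positivity), ← Real.sqrt_eq_rpow] at h2
  have e1 : 2 / p * (1 / 2) = 1 / p := by field_simp
  have e2 : (2 / p - 1) * (1 / 2) = 1 / p - 1 / 2 := by field_simp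
  rwa [e1, e2] at h2

lemma le_lpNm (hn : 0 < n) (hp : 1 ≤ p) (x : Fin n → ℝ) :
    (n : ℝ) ^ (1 / p - 1) * ∑ i, |x i| ≤ lpNm p x := by
  have hn' : (0 : ℝ) < n := by exact_mod_cast hn
  have hp0 : 0 < p := by linarith
  have h := Real.rpow_sum_le_const_mul_sum_rpow_of_nonneg (s := Finset.univ)
    (f := fun i => |x i|) hp (fun i _ => by positivity)
  rw [Finset.card_univ, Fintype.card_fin] at h
  have h2 := Real.rpow_le_rpow (by positivity) h (show (0 : ℝ) ≤ 1 / p by positivity)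
  rw [Real.mul_rpow (by positivity) (by positivity), ← Real.rpow_mul (by positivity),
    ← Real.rpow_mul (by positivity), mul_one_div_cancel hp0.ne', Real.rpow_one] at h2
  calc (n : ℝ) ^ (1 / p - 1) * ∑ i, |x i|
      ≤ (n : ℝ) ^ (1 / p - 1) * ((n : ℝ) ^ ((p - 1) * (1 / p)) * lpNm p x) := by
        gcongr
    _ = lpNm p x := by
        rw [← mul_assoc, ← Real.rpow_add hn']
        have : 1 / p - 1 + (p - 1) * (1 / p) = 0 := by field_simp; ring
        rw [this, Real.rpow_zero, one_mul]

lemma sqrt_rpow_le_exp {r : ℝ} (hr : 1 ≤ r) (q : ℝ) :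
    √q ^ r ≤ √(2 * r) ^ r * Real.exp (1 / 4 * q) := by
  have h1 : √q ≤ √(2 * r) * Real.exp (q / (4 * r)) := by
    refine Real.sqrt_le_iff.2 ⟨by positivity, ?_⟩
    rw [mul_pow, Real.sq_sqrt (by positivity), ← Real.exp_nat_mul]
    have h2 := Real.add_one_le_exp ((2 : ℕ) * (q / (4 * r)))
    have h3 : 2 * r * ((2 : ℕ) * (q / (4 * r))) = q := by push_cast; field_simp; ring
    nlinarith
  calc √q ^ r ≤ (√(2 * r) * Real.exp (q / (4 * r))) ^ r :=
        Real.rpow_le_rpow (by positivity) h1 (by linarith)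
    _ = _ := by
        rw [Real.mul_rpow (by positivity) (by positivity), ← Real.exp_mul]
        congr 2
        field_simp

end deterministic

section moments

variable {n : ℕ} {p r : ℝ}

lemma lpNm_rpow_le (hn : 0 < n) (hp : 1 ≤ p) (hp2 : p ≤ 2) (hr : 1 ≤ r) (x : Fin n → ℝ) :
    lpNm p x ^ r ≤ ((n : ℝ) ^ (1 / p - 1 / 2) * √(2 * r)) ^ r *
      Real.exp (1 / 4 * ∑ i, x i ^ 2) := by
  calc lpNm p x ^ r ≤ ((n : ℝ) ^ (1 / p - 1 / 2) * √(∑ i, x i ^ 2)) ^ r :=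
        Real.rpow_le_rpow (lpNm_nonneg x) (lpNm_le hn hp hp2 x) (by linarith)
    _ ≤ _ := by
        rw [Real.mul_rpow (by positivity) (by positivity),
          Real.mul_rpow (by positivity) (by positivity), mul_assoc]
        gcongr
        exact sqrt_rpow_le_exp hr _

lemma integrable_lpNm_rpow (hn : 0 < n) (hp : 1 ≤ p) (hp2 : p ≤ 2) (hr : 1 ≤ r) :
    Integrable (fun x => lpNm p x ^ r) (stdGauss n) := by
  refine Integrable.mono' ((integrable_exp_sum_sq_stdGauss n (t := 1 / 4) (by norm_num)).const_mul
    (((n : ℝ) ^ (1 / p - 1 / 2) * √(2 * r)) ^ r)) ?_ (ae_of_all _ fun x => ?_)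
  · exact ((continuous_lpNm hp).rpow_const fun _ => Or.inr (by linarith)).aestronglyMeasurable
  · rw [Real.norm_of_nonneg (Real.rpow_nonneg (lpNm_nonneg x) r)]
    exact lpNm_rpow_le hn hp hp2 hr x

lemma memLp_lpNm (hn : 0 < n) (hp : 1 ≤ p) (hp2 : p ≤ 2) (hr : 1 ≤ r) :
    MemLp (lpNm p) (ENNReal.ofReal r) (stdGauss n) := by
  rw [← integrable_norm_rpow_iff (continuous_lpNm hp).aestronglyMeasurable
    (by simp; linarith) ENNReal.ofReal_ne_top, ENNReal.toReal_ofReal (by linarith)]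
  simp only [Real.norm_of_nonneg (lpNm_nonneg _)]
  exact integrable_lpNm_rpow hn hp hp2 hr

lemma memLp_lpNm_sub (hn : 0 < n) (hp : 1 ≤ p) (hp2 : p ≤ 2) (hr : 1 ≤ r) (a : ℝ) :
    MemLp (fun x => lpNm p x - a) (ENNReal.ofReal r) (stdGauss n) :=
  (memLp_lpNm hn hp hp2 hr).sub (memLp_const a)

lemma integrable_lpNm (hn : 0 < n) (hp : 1 ≤ p) (hp2 : p ≤ 2) :
    Integrable (lpNm p) (stdGauss n) := by
  simpa using integrable_lpNm_rpow hn hp hp2 le_rfl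

lemma integrable_abs_lpNm_sub_rpow (hn : 0 < n) (hp : 1 ≤ p) (hp2 : p ≤ 2) (hr : 1 ≤ r) (a : ℝ) :
    Integrable (fun x => |lpNm p x - a| ^ r) (stdGauss n) := by
  have h := (memLp_lpNm_sub hn hp hp2 hr a).integrable_norm_rpow
    (by simp; linarith) ENNReal.ofReal_ne_top
  rwa [ENNReal.toReal_ofReal (by linarith)] at h

lemma integral_lpNm_rpow_le (hn : 0 < n) (hp : 1 ≤ p) (hp2 : p ≤ 2) (hr : 1 ≤ r) (hnr : n ≤ r) :
    ∫ x, lpNm p x ^ r ∂stdGauss n ≤ (2 * ((n : ℝ) ^ (1 / p - 1 / 2) * √r)) ^ r := by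
  have hs2 : (1 : ℝ) ≤ √2 := by rw [Real.one_le_sqrt]; norm_num
  calc ∫ x, lpNm p x ^ r ∂stdGauss n
      ≤ ∫ x, ((n : ℝ) ^ (1 / p - 1 / 2) * √(2 * r)) ^ r *
          Real.exp (1 / 4 * ∑ i, x i ^ 2) ∂stdGauss n :=
        integral_mono (integrable_lpNm_rpow hn hp hp2 hr)
          ((integrable_exp_sum_sq_stdGauss n (by norm_num)).const_mul _)
          (lpNm_rpow_le hn hp hp2 hr)
    _ = ((n : ℝ) ^ (1 / p - 1 / 2) * √(2 * r)) ^ r * √2 ^ n := by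
        rw [integral_const_mul, integral_exp_sum_sq_stdGauss n (by norm_num), ← Real.sqrt_inv]
        norm_num
    _ ≤ ((n : ℝ) ^ (1 / p - 1 / 2) * √(2 * r)) ^ r * √2 ^ r := by
        gcongr
        rw [← Real.rpow_natCast]
        exact Real.rpow_le_rpow_of_exponent_le hs2 hnr
    _ = _ := by
        rw [← Real.mul_rpow (by positivity) (by positivity)]
        congr 1
        rw [Real.sqrt_mul (by norm_num)]
        linear_combination ((n : ℝ) ^ (1 / p - 1 / 2) * √r) * Real.mul_self_sqrt (show (0 : ℝ) ≤ 2 by norm_num)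

/-- Replacing a constant by the mean costs at most a factor `2 ^ r` in the `r`-th moment. -/
lemma integral_abs_sub_mean_rpow_le {Ω : Type*} [MeasurableSpace Ω] {μ : Measure Ω}
    [IsProbabilityMeasure μ] {f : Ω → ℝ} (hr : 1 ≤ r) (a : ℝ) (hf : Integrable f μ)
    (hfr : ∀ b : ℝ, Integrable (fun x => |f x - b| ^ r) μ) :
    ∫ x, |f x - ∫ y, f y ∂μ| ^ r ∂μ ≤ 2 ^ r * ∫ x, |f x - a| ^ r ∂μ := by
  set m := ∫ y, f y ∂μ with hm
  have hJ : |m - a| ^ r ≤ ∫ x, |f x - a| ^ r ∂μ := by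
    have h1 : |m - a| ≤ ∫ x, |f x - a| ∂μ := by
      have : m - a = ∫ x, (f x - a) ∂μ := by
        rw [integral_sub hf (integrable_const a)]; simp [hm]
      rw [this]
      exact abs_integral_le_integral_abs
    refine (Real.rpow_le_rpow (abs_nonneg _) h1 (by linarith)).trans ?_
    exact (convexOn_rpow hr).map_integral_le
      (Real.continuous_rpow_const (by linarith)).continuousOn
      isClosed_Ici (ae_of_all _ fun x => abs_nonneg (f x - a))
      (hf.sub (integrable_const a)).abs (hfr a)
  have hpt : ∀ x, |f x - m| ^ r ≤ 2 ^ (r - 1) * (|f x - a| ^ r + |m - a| ^ r) := by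
    intro x
    have h1 : |f x - m| ≤ |f x - a| + |m - a| := by
      rw [abs_sub_comm m a]; exact abs_sub_le _ _ _
    refine (Real.rpow_le_rpow (abs_nonneg _) h1 (by linarith)).trans ?_
    exact_mod_cast NNReal.rpow_add_le_mul_rpow_add_rpow ‖f x - a‖₊ ‖m - a‖₊ hr
  calc ∫ x, |f x - m| ^ r ∂μ
      ≤ ∫ x, 2 ^ (r - 1) * (|f x - a| ^ r + |m - a| ^ r) ∂μ :=
        integral_mono (hfr m) (((hfr a).add (integrable_const _)).const_mul _) hpt
    _ = 2 ^ (r - 1) * (∫ x, |f x - a| ^ r ∂μ + |m - a| ^ r) := by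
        rw [integral_const_mul, integral_add (hfr a) (integrable_const _)]
        simp
    _ ≤ 2 ^ (r - 1) * (2 * ∫ x, |f x - a| ^ r ∂μ) := by gcongr; linarith
    _ = 2 ^ r * ∫ x, |f x - a| ^ r ∂μ := by
        rw [← mul_assoc, ← Real.rpow_add_one (by norm_num)]; simp

end moments

section lower

lemma scale_exponent_le {n : ℕ} (hn : 0 < n) {r : ℝ} (hr : 2 ≤ r) {s : ℝ}
    (hs : s = 1 + √(r / n) / 10) :
    (1 / (r - 1)) * (s ^ 2 - 1) ≤ 1 / 2 ∧
      (s ^ n) ^ (-(1 / (r - 1))) * (√(1 - (1 / (r - 1)) * (s ^ 2 - 1)))⁻¹ ^ n ≤ Real.exp 1 := by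
  have hn1 : (1 : ℝ) ≤ n := by exact_mod_cast hn
  have hn0 : (0 : ℝ) < n := by linarith
  set τ := √(r / n) with hτ
  have hτ0 : 0 ≤ τ := Real.sqrt_nonneg _
  have hτsq : τ ^ 2 * n = r := by
    rw [hτ, Real.sq_sqrt (by positivity)]; field_simp
  have hτr : τ ^ 2 ≤ r := by nlinarith [sq_nonneg τ]
  have hτr' : τ ≤ r := by nlinarith
  set l := 1 / (r - 1) with hl
  have hl0 : 0 < l := by rw [hl]; apply one_div_pos.2; linarith
  have hlr : l * r ≤ 2 := by rw [hl, one_div_mul_eq_div, div_le_iff₀ (by linarith)]; linarith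
  have hl1 : l ≤ 1 := by rw [hl, div_le_one (by linarith)]; linarith
  have hs1 : 1 ≤ s := by rw [hs]; linarith [hτ0]
  have hu : s ^ 2 - 1 = τ / 5 + τ ^ 2 / 100 := by rw [hs]; ring
  have hlu0 : 0 ≤ l * (s ^ 2 - 1) := by rw [hu]; positivity
  have hlu : l * (s ^ 2 - 1) ≤ 1 / 2 := by
    rw [hu]; nlinarith [mul_le_mul_of_nonneg_left hτr hl0.le, mul_le_mul_of_nonneg_left hτr' hl0.le]
  refine ⟨hlu, ?_⟩
  set y := l * (s ^ 2 - 1) with hy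
  have hlogs : τ / 10 - τ ^ 2 / 100 ≤ Real.log s := by
    have h1 := Real.one_sub_inv_le_log_of_pos (show 0 < s by linarith)
    have h2 : τ / 10 - τ ^ 2 / 100 ≤ 1 - s⁻¹ := by
      have : 1 - s⁻¹ = (s - 1) / s := by field_simp
      rw [this, le_div_iff₀ (by linarith), hs]
      nlinarith [pow_nonneg hτ0 3]
    linarith
  have hlogy : -Real.log (1 - y) ≤ y + 2 * y ^ 2 := by
    have h1 := Real.one_sub_inv_le_log_of_pos (show 0 < 1 - y by linarith)
    have h2 : (1 - y)⁻¹ ≤ 1 + y + 2 * y ^ 2 := by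
      rw [inv_le_iff_one_le_mul₀ (by linarith)]
      nlinarith [mul_nonneg (sq_nonneg y) (show 0 ≤ 1 - 2 * y by linarith)]
    linarith
  have hlhs : (s ^ n) ^ (-l) * (√(1 - y))⁻¹ ^ n =
      Real.exp (n * (-l * Real.log s + 1 / 2 * (-Real.log (1 - y)))) := by
    rw [mul_add, Real.exp_add, ← Real.rpow_natCast s n, ← Real.rpow_mul (by linarith),
      Real.rpow_def_of_pos (by linarith), Real.sqrt_eq_rpow, ← Real.rpow_neg (by linarith),
      ← Real.rpow_natCast, ← Real.rpow_mul (by linarith),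
      Real.rpow_def_of_pos (show 0 < 1 - y by linarith)]
    congr 2 <;> ring
  rw [hlhs]
  refine Real.exp_le_exp.2 ?_
  have hy2 : n * y ^ 2 ≤ 1 / 5 := by
    have h1 : y ^ 2 ≤ l ^ 2 * (2 * (τ ^ 2 / 25 + τ ^ 4 / 10000)) := by
      rw [hy, hu, mul_pow]
      gcongr
      nlinarith [sq_nonneg (τ / 5 - τ ^ 2 / 100)]
    have h2 : n * (l ^ 2 * (2 * (τ ^ 2 / 25 + τ ^ 4 / 10000))) =
        2 / 25 * (l * (l * r)) + 2 / 10000 * ((l * r) * (l * τ ^ 2)) := by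
      linear_combination (2 / 25 * l ^ 2 + 2 / 10000 * l ^ 2 * τ ^ 2) * hτsq
    have h3 : l * (l * r) ≤ 1 * 2 := by gcongr
    have h4 : l * τ ^ 2 ≤ 2 := (mul_le_mul_of_nonneg_left hτr hl0.le).trans hlr
    have h5 : (l * r) * (l * τ ^ 2) ≤ 2 * 2 := by gcongr
    calc n * y ^ 2 ≤ n * (l ^ 2 * (2 * (τ ^ 2 / 25 + τ ^ 4 / 10000))) := by gcongr
      _ ≤ 1 / 5 := by rw [h2]; linarith
  have hlin : n * (-l * Real.log s + 1 / 2 * y) ≤ 3 / 100 := by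
    have h1 : -l * Real.log s + 1 / 2 * y ≤ l * (3 / 200 * τ ^ 2) := by
      rw [hy, hu]
      nlinarith [mul_le_mul_of_nonneg_left hlogs hl0.le]
    calc n * (-l * Real.log s + 1 / 2 * y) ≤ n * (l * (3 / 200 * τ ^ 2)) := by gcongr
      _ = 3 / 200 * (l * r) := by rw [← hτsq]; ring
      _ ≤ 3 / 100 := by linarith
  have h6 : n * (-l * Real.log s + 1 / 2 * (-Real.log (1 - y))) ≤
      n * (-l * Real.log s + 1 / 2 * (y + 2 * y ^ 2)) := by gcongr
  nlinarith

variable {n : ℕ} {p r : ℝ}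

/-- Lower bound for the centered moments of order at least two: rescale the Gaussian measure and
apply Hölder's inequality against the density. -/
lemma le_integral_abs_lpNm_sub_mean_rpow (hn : 0 < n) (hp : 1 ≤ p) (hp2 : p ≤ 2) (hr : 2 ≤ r) :
    (Real.exp 1)⁻¹ / 10 * √(r / n) * (∫ x, lpNm p x ∂stdGauss n) ≤
      (∫ x, |lpNm p x - ∫ y, lpNm p y ∂stdGauss n| ^ r ∂stdGauss n) ^ (1 / r) := by
  set m := ∫ y, lpNm p y ∂stdGauss n with hm
  have hm0 : 0 ≤ m := integral_nonneg fun x => lpNm_nonneg x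
  have hr0 : 0 < r := by linarith
  obtain ⟨s, hs⟩ : ∃ s, s = 1 + √(r / n) / 10 := ⟨_, rfl⟩
  have hs1 : 1 ≤ s := by rw [hs]; linarith [Real.sqrt_nonneg (r / n)]
  have hs0 : 0 < s := by linarith
  obtain ⟨hlu, hexp⟩ := scale_exponent_le hn hr hs
  set l := 1 / (r - 1) with hl
  set w : (Fin n → ℝ) → ℝ := fun x => s ^ n * Real.exp (-((s ^ 2 - 1) / 2 * ∑ i, x i ^ 2)) with hw
  have hw0 : ∀ x, 0 < w x := fun x => by positivity
  have hwc : Continuous w := by fun_prop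
  have hf := continuous_lpNm (n := n) hp
  set F : (Fin n → ℝ) → ℝ := fun x => |s * lpNm p x - m| * w x ^ (1 / r) with hF
  set G : (Fin n → ℝ) → ℝ := fun x => w x ^ (-(1 / r)) with hG
  have hF0 : ∀ x, 0 ≤ F x := fun x => by have := (hw0 x).le; positivity
  have hG0 : ∀ x, 0 ≤ G x := fun x => Real.rpow_nonneg (hw0 x).le _
  have hFc : Continuous F :=
    ((continuous_const.mul hf).sub continuous_const).abs.mul
      (hwc.rpow_const fun x => Or.inl (hw0 x).ne')
  have hGc : Continuous G := hwc.rpow_const fun x => Or.inl (hw0 x).ne'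
  have hFr : ∀ x, F x ^ r = w x * |s * lpNm p x - m| ^ r := fun x => by
    rw [hF]
    simp only
    rw [Real.mul_rpow (abs_nonneg _) (Real.rpow_nonneg (hw0 x).le _), ← Real.rpow_mul (hw0 x).le,
      one_div_mul_cancel hr0.ne', Real.rpow_one, mul_comm]
  have hq : r.HolderConjugate (r.conjExponent) := Real.HolderConjugate.conjExponent (by linarith)
  set q := r.conjExponent with hqd
  have hq0 : 0 < q := hq.symm.pos
  have hq1 : 1 < q := hq.symm.lt
  have hqr : -(1 / r) * q = -l := by
    rw [hqd, hl, Real.conjExponent]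
    have : r - 1 ≠ 0 := by linarith
    field_simp
  have hGq : ∀ x, G x ^ q = (s ^ n) ^ (-l) * Real.exp (l * (s ^ 2 - 1) / 2 * ∑ i, x i ^ 2) :=
    fun x => by
    rw [hG]
    simp only
    rw [← Real.rpow_mul (hw0 x).le, hqr, hw]
    simp only
    rw [Real.mul_rpow (by positivity) (by positivity), ← Real.exp_mul]
    congr 2
    ring
  have hGqi : Integrable (fun x => G x ^ q) (stdGauss n) := by
    simp only [hGq]
    exact (integrable_exp_sum_sq_stdGauss n (by linarith)).const_mul _
  have hFri : Integrable (fun x => F x ^ r) (stdGauss n) := by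
    have h1 : Integrable (fun x => s ^ n * (s ^ r * |lpNm p x - m / s| ^ r)) (stdGauss n) :=
      ((integrable_abs_lpNm_sub_rpow hn hp hp2 (by linarith) (m / s)).const_mul _).const_mul _
    refine h1.mono' (hFc.rpow_const fun _ => Or.inr hr0.le).aestronglyMeasurable
      (ae_of_all _ fun x => ?_)
    rw [Real.norm_of_nonneg (Real.rpow_nonneg (hF0 x) r), hFr]
    have h2 : |s * lpNm p x - m| = s * |lpNm p x - m / s| := by
      rw [← abs_of_pos hs0, ← abs_mul, abs_of_pos hs0, mul_sub, mul_div_cancel₀ _ hs0.ne']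
    rw [h2, Real.mul_rpow hs0.le (abs_nonneg _)]
    gcongr
    rw [hw]
    refine mul_le_of_le_one_right (by positivity) (Real.exp_le_one_iff.2 ?_)
    have : 0 ≤ s ^ 2 - 1 := by nlinarith
    have h3 : 0 ≤ ∑ i, x i ^ 2 := by positivity
    have := mul_nonneg (div_nonneg this zero_le_two) h3
    linarith
  have hFL : MemLp F (ENNReal.ofReal r) (stdGauss n) := by
    rw [← integrable_norm_rpow_iff hFc.aestronglyMeasurable (by simp; linarith)
      ENNReal.ofReal_ne_top, ENNReal.toReal_ofReal hr0.le]
    simpa only [Real.norm_of_nonneg (hF0 _)] using hFri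
  have hGL : MemLp G (ENNReal.ofReal q) (stdGauss n) := by
    rw [← integrable_norm_rpow_iff hGc.aestronglyMeasurable (by simp; linarith)
      ENNReal.ofReal_ne_top, ENNReal.toReal_ofReal hq0.le]
    simpa only [Real.norm_of_nonneg (hG0 _)] using hGqi
  have hH := integral_mul_le_Lp_mul_Lq_of_nonneg hq (ae_of_all _ hF0) (ae_of_all _ hG0) hFL hGL
  have hFG : ∀ x, F x * G x = |s * lpNm p x - m| := fun x => by
    rw [hF, hG]
    simp only
    rw [mul_assoc, ← Real.rpow_add (hw0 x), add_neg_cancel, Real.rpow_zero, mul_one]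
  have hleft : √(r / n) / 10 * m ≤ ∫ x, F x * G x ∂stdGauss n := by
    have hi := integrable_lpNm hn hp hp2
    have h1 : ∫ x, (s * lpNm p x - m) ∂stdGauss n = √(r / n) / 10 * m := by
      rw [integral_sub (hi.const_mul s) (integrable_const m), integral_const_mul, ← hm]
      simp only [integral_const, probReal_univ, one_smul]
      rw [hs]; ring
    simp only [hFG]
    rw [← h1]
    exact (le_abs_self _).trans abs_integral_le_integral_abs
  have hFint : ∫ x, F x ^ r ∂stdGauss n = ∫ x, |lpNm p x - m| ^ r ∂stdGauss n := by
    rw [integral_stdGauss_eq_scale n hs0 (fun x => |lpNm p x - m| ^ r)]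
    simp only [hFr, hw, lpNm_smul hp hs0.le]
  have hGint : (∫ x, G x ^ q ∂stdGauss n) ^ (1 / q) ≤ Real.exp 1 := by
    have h1 : ∫ x, G x ^ q ∂stdGauss n ≤ Real.exp 1 := by
      simp only [hGq]
      rw [integral_const_mul, integral_exp_sum_sq_stdGauss n (by linarith)]
      convert! hexp using 5
      ring
    calc (∫ x, G x ^ q ∂stdGauss n) ^ (1 / q) ≤ (Real.exp 1) ^ (1 / q) :=
          Real.rpow_le_rpow (integral_nonneg fun x => Real.rpow_nonneg (hG0 x) q) h1 (by positivity)
      _ ≤ (Real.exp 1) ^ (1 : ℝ) := by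
          refine Real.rpow_le_rpow_of_exponent_le (Real.one_le_exp zero_le_one) ?_
          rw [div_le_one hq0]; exact hq1.le
      _ = Real.exp 1 := Real.rpow_one _
  rw [hFint] at hH
  have hE : 0 < Real.exp 1 := Real.exp_pos 1
  have hfin : √(r / n) / 10 * m ≤
      (∫ x, |lpNm p x - m| ^ r ∂stdGauss n) ^ (1 / r) * Real.exp 1 :=
    hleft.trans (hH.trans (by gcongr))
  calc (Real.exp 1)⁻¹ / 10 * √(r / n) * m = (√(r / n) / 10 * m) / Real.exp 1 := by
        field_simp
    _ ≤ _ := by rwa [div_le_iff₀ hE]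

end lower

section upper

lemma exp_le_one_add_add_sq_mul_exp_abs (u : ℝ) :
    Real.exp u ≤ 1 + u + u ^ 2 * Real.exp |u| := by
  rcases le_or_gt |u| 1 with h | h
  · have h1 := (abs_le.1 (Real.abs_exp_sub_one_sub_id_le h)).2
    have h2 := Real.one_le_exp (abs_nonneg u)
    nlinarith [sq_nonneg u]
  · have h2 : 1 ≤ u ^ 2 := by rw [← sq_abs]; nlinarith
    rcases le_or_gt 0 u with h0 | h0
    · rw [abs_of_nonneg h0]
      nlinarith [Real.exp_pos u]
    · have h3 := Real.one_le_exp (abs_nonneg u)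
      have h4 := Real.exp_le_one_iff.2 h0.le
      rw [abs_of_neg h0] at h
      nlinarith

lemma abs_rpow_le_one_add_sq {p : ℝ} (hp : 1 ≤ p) (hp2 : p ≤ 2) (x : ℝ) :
    |x| ^ p ≤ 1 + x ^ 2 := by
  rcases le_total |x| 1 with h | h
  · have := Real.rpow_le_one (abs_nonneg x) h (show 0 ≤ p by linarith)
    nlinarith [sq_nonneg x]
  · have := Real.rpow_le_rpow_of_exponent_le h hp2
    rw [Real.rpow_two, sq_abs] at this
    linarith

lemma integrable_abs_rpow_gaussianReal {p : ℝ} (hp : 1 ≤ p) (hp2 : p ≤ 2) :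
    Integrable (fun x => |x| ^ p) (gaussianReal 0 1) := by
  refine ((integrable_exp_mul_sq_gaussianReal (t := 1 / 4) (by norm_num)).const_mul 4).mono'
    (Continuous.aestronglyMeasurable (continuous_abs.rpow_const fun _ => Or.inr (by linarith)))
    (ae_of_all _ fun x => ?_)
  rw [Real.norm_of_nonneg (by positivity)]
  linarith [abs_rpow_le_one_add_sq hp hp2 x, Real.add_one_le_exp (1 / 4 * x ^ 2)]

/-- The absolute moment of order `p` of a standard Gaussian variable. -/
noncomputable def gaussMoment (p : ℝ) : ℝ := ∫ x, |x| ^ p ∂gaussianReal 0 1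

lemma gaussMoment_nonneg (p : ℝ) : 0 ≤ gaussMoment p := integral_nonneg fun _ => by positivity

lemma gaussMoment_le {p : ℝ} (hp : 1 ≤ p) (hp2 : p ≤ 2) : gaussMoment p ≤ 6 := by
  have h1 : gaussMoment p ≤ ∫ x, 4 * Real.exp (1 / 4 * x ^ 2) ∂gaussianReal 0 1 :=
    integral_mono (integrable_abs_rpow_gaussianReal hp hp2)
      ((integrable_exp_mul_sq_gaussianReal (by norm_num)).const_mul _) fun x => by
        simp only
        linarith [abs_rpow_le_one_add_sq hp hp2 x, Real.add_one_le_exp (1 / 4 * x ^ 2)]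
  rw [integral_const_mul, integral_exp_mul_sq_gaussianReal (by norm_num), ← Real.sqrt_inv] at h1
  have h2 : √(1 - 2 * (1 / 4))⁻¹ ≤ (3 / 2 : ℝ) := by
    rw [Real.sqrt_le_iff]; norm_num
  linarith

lemma exists_pos_le_gaussMoment :
    ∃ κ : ℝ, 0 < κ ∧ κ ≤ 1 ∧ ∀ p : ℝ, 1 ≤ p → p ≤ 2 → κ ≤ gaussMoment p := by
  set φ : ℝ → ℝ := fun x => min (min |x| (x ^ 2)) 1 with hφ
  have hφ0 : ∀ x, 0 ≤ φ x := fun x => le_min (le_min (abs_nonneg x) (sq_nonneg x)) zero_le_one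
  have hφ1 : ∀ x, φ x ≤ 1 := fun x => min_le_right _ _
  have hφc : Continuous φ := by fun_prop
  have hφi : Integrable φ (gaussianReal 0 1) :=
    (integrable_const (1 : ℝ)).mono' hφc.aestronglyMeasurable
      (ae_of_all _ fun x => by rw [Real.norm_of_nonneg (hφ0 x)]; exact hφ1 x)
  refine ⟨∫ x, φ x ∂gaussianReal 0 1, ?_, ?_, fun p hp hp2 => ?_⟩
  · rw [integral_pos_iff_support_of_nonneg hφ0 hφi]
    have hsupp : Function.support φ = {0}ᶜ := by
      ext x
      simp only [Function.mem_support, Set.mem_compl_iff, Set.mem_singleton_iff]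
      refine not_congr ⟨fun h => ?_, fun h => by simp [hφ, h]⟩
      by_contra hx
      have : 0 < φ x := lt_min (lt_min (abs_pos.2 hx) (by positivity)) one_pos
      linarith
    have := nullSingletonClass_gaussianReal (μ := 0) (v := 1) one_ne_zero
    rw [hsupp, prob_compl_eq_one_sub (measurableSet_singleton 0), measure_singleton]
    simp
  · calc ∫ x, φ x ∂gaussianReal 0 1 ≤ ∫ _, (1 : ℝ) ∂gaussianReal 0 1 :=
          integral_mono hφi (integrable_const _) hφ1
      _ = 1 := by simp
  · refine integral_mono hφi (integrable_abs_rpow_gaussianReal hp hp2) fun x => ?_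
    refine (min_le_left _ _).trans ?_
    rcases le_total |x| 1 with h | h
    · refine (min_le_right _ _).trans ?_
      rw [← sq_abs, ← Real.rpow_two]
      exact Real.rpow_le_rpow_of_exponent_ge' (abs_nonneg x) h (by linarith) hp2
    · refine (min_le_left _ _).trans ?_
      simpa using Real.rpow_le_rpow_of_exponent_le h hp

lemma abs_abs_rpow_sub_gaussMoment_le {p : ℝ} (hp : 1 ≤ p) (hp2 : p ≤ 2) (x : ℝ) :
    |(|x| ^ p - gaussMoment p)| ≤ x ^ 2 + 6 := by
  have h1 := abs_rpow_le_one_add_sq hp hp2 x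
  have h2 := gaussMoment_le hp hp2
  have h3 := gaussMoment_nonneg p
  have h4 : 0 ≤ |x| ^ p := by positivity
  rw [abs_le]
  constructor <;> nlinarith [sq_nonneg x]

lemma integrable_exp_centered {p t : ℝ} (hp : 1 ≤ p) (hp2 : p ≤ 2) (ht : |t| ≤ 1 / 8) :
    Integrable (fun x => Real.exp (t * (|x| ^ p - gaussMoment p))) (gaussianReal 0 1) := by
  refine ((integrable_exp_mul_sq_gaussianReal (t := 1 / 8) (by norm_num)).const_mul
    (Real.exp (6 / 8))).mono' (Continuous.aestronglyMeasurable ?_) (ae_of_all _ fun x => ?_)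
  · exact Real.continuous_exp.comp (continuous_const.mul
      ((continuous_abs.rpow_const fun _ => Or.inr (by linarith)).sub continuous_const))
  · rw [Real.norm_of_nonneg (Real.exp_pos _).le, ← Real.exp_add]
    refine Real.exp_le_exp.2 ((le_abs_self _).trans ?_)
    rw [abs_mul]
    calc |t| * |(|x| ^ p - gaussMoment p)| ≤ 1 / 8 * (x ^ 2 + 6) := by
          gcongr
          exact abs_abs_rpow_sub_gaussMoment_le hp hp2 x
      _ = _ := by ring

lemma integral_exp_centered_le {p t : ℝ} (hp : 1 ≤ p) (hp2 : p ≤ 2) (ht : |t| ≤ 1 / 8) :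
    ∫ x, Real.exp (t * (|x| ^ p - gaussMoment p)) ∂gaussianReal 0 1 ≤
      Real.exp (256 * Real.exp 2 * t ^ 2) := by
  have hpt : ∀ x, Real.exp (t * (|x| ^ p - gaussMoment p)) ≤
      1 + t * (|x| ^ p - gaussMoment p) +
        t ^ 2 * (128 * Real.exp (6 / 4) * Real.exp (1 / 4 * x ^ 2)) := by
    intro x
    set g := |x| ^ p - gaussMoment p with hg
    have hgx : |g| ≤ x ^ 2 + 6 := abs_abs_rpow_sub_gaussMoment_le hp hp2 x
    refine (exp_le_one_add_add_sq_mul_exp_abs _).trans ?_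
    have h1 : g ^ 2 ≤ 128 * Real.exp (|g| / 8) := by
      have := Real.quadratic_le_exp_of_nonneg (show 0 ≤ |g| / 8 by positivity)
      nlinarith [abs_nonneg g, sq_abs g]
    have h2 : Real.exp |t * g| ≤ Real.exp (|g| / 8) := by
      rw [abs_mul]
      refine Real.exp_le_exp.2 ?_
      nlinarith [abs_nonneg g]
    have h3 : g ^ 2 * Real.exp |t * g| ≤ 128 * Real.exp (6 / 4) * Real.exp (1 / 4 * x ^ 2) := by
      calc g ^ 2 * Real.exp |t * g| ≤ 128 * Real.exp (|g| / 8) * Real.exp (|g| / 8) := by gcongr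
        _ = 128 * Real.exp (|g| / 4) := by
          rw [mul_assoc, ← Real.exp_add]; ring_nf
        _ ≤ 128 * Real.exp (6 / 4 + 1 / 4 * x ^ 2) := by gcongr; linarith
        _ = _ := by rw [Real.exp_add]; ring
    rw [mul_pow, mul_assoc (t ^ 2)]
    gcongr
  have hi := integrable_abs_rpow_gaussianReal hp hp2
  have hc : Integrable (fun x => |x| ^ p - gaussMoment p) (gaussianReal 0 1) :=
    hi.sub (integrable_const _)
  have hc0 : ∫ x, (|x| ^ p - gaussMoment p) ∂gaussianReal 0 1 = 0 := by
    rw [integral_sub hi (integrable_const _)]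
    simp [gaussMoment]
  have he := (integrable_exp_mul_sq_gaussianReal (t := 1 / 4) (by norm_num)).const_mul
    (128 * Real.exp (6 / 4))
  have h1 : Integrable (fun x => 1 + t * (|x| ^ p - gaussMoment p)) (gaussianReal 0 1) :=
    (integrable_const 1).add (hc.const_mul t)
  have hsq : (√(1 - 2 * (1 / 4)))⁻¹ ≤ (2 : ℝ) := by
    rw [← Real.sqrt_inv, Real.sqrt_le_iff]; norm_num
  have hee : Real.exp (6 / 4) ≤ Real.exp 2 := Real.exp_le_exp.2 (by norm_num)
  calc ∫ x, Real.exp (t * (|x| ^ p - gaussMoment p)) ∂gaussianReal 0 1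
      ≤ ∫ x, (1 + t * (|x| ^ p - gaussMoment p) +
        t ^ 2 * (128 * Real.exp (6 / 4) * Real.exp (1 / 4 * x ^ 2))) ∂gaussianReal 0 1 :=
        integral_mono (integrable_exp_centered hp hp2 ht) (h1.add (he.const_mul _)) hpt
    _ = 1 + t ^ 2 * (128 * Real.exp (6 / 4) * (√(1 - 2 * (1 / 4)))⁻¹) := by
        rw [integral_add h1 (he.const_mul _), integral_add (integrable_const _) (hc.const_mul t),
          integral_const_mul, hc0, integral_const_mul, integral_const_mul,
          integral_exp_mul_sq_gaussianReal (by norm_num)]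
        simp
    _ ≤ 1 + t ^ 2 * (128 * Real.exp 2 * 2) := by gcongr
    _ ≤ Real.exp (256 * Real.exp 2 * t ^ 2) := by
        have := Real.add_one_le_exp (256 * Real.exp 2 * t ^ 2)
        linarith

lemma exp_sum_centered (n : ℕ) (p t : ℝ) (x : Fin n → ℝ) :
    Real.exp (t * (∑ i, |x i| ^ p - n * gaussMoment p)) =
      ∏ i, Real.exp (t * (|x i| ^ p - gaussMoment p)) := by
  rw [← Real.exp_sum, ← Finset.mul_sum, Finset.sum_sub_distrib]
  simp

lemma integrable_exp_sum_centered (n : ℕ) {p t : ℝ} (hp : 1 ≤ p) (hp2 : p ≤ 2)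
    (ht : |t| ≤ 1 / 8) :
    Integrable (fun x => Real.exp (t * (∑ i, |x i| ^ p - n * gaussMoment p))) (stdGauss n) := by
  simp only [exp_sum_centered]
  exact Integrable.fintype_prod fun _ => integrable_exp_centered hp hp2 ht

lemma integral_exp_sum_centered_le (n : ℕ) {p t : ℝ} (hp : 1 ≤ p) (hp2 : p ≤ 2)
    (ht : |t| ≤ 1 / 8) :
    ∫ x, Real.exp (t * (∑ i, |x i| ^ p - n * gaussMoment p)) ∂stdGauss n ≤
      Real.exp (256 * Real.exp 2 * (n * t ^ 2)) := by
  simp only [exp_sum_centered]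
  rw [integral_fintype_prod_eq_pow
    (fun y : ℝ => Real.exp (t * (|y| ^ p - gaussMoment p))), Fintype.card_fin]
  calc _ ≤ Real.exp (256 * Real.exp 2 * t ^ 2) ^ n := by
        gcongr
        exact integral_exp_centered_le hp hp2 ht
    _ = _ := by rw [← Real.exp_nat_mul]; ring_nf

lemma abs_rpow_le_mul_exp_add_exp {r l : ℝ} (hr : 1 ≤ r) (hl : 0 < l) (y : ℝ) :
    |y| ^ r ≤ (r / l) ^ r * (Real.exp (l * y) + Real.exp (-l * y)) := by
  have h1 : |y| ≤ r / l * Real.exp (l * |y| / r) := by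
    have := Real.add_one_le_exp (l * |y| / r)
    calc |y| = r / l * (l * |y| / r) := by field_simp
      _ ≤ _ := by gcongr; linarith
  have h2 : Real.exp (l * |y|) ≤ Real.exp (l * y) + Real.exp (-l * y) := by
    rcases abs_cases y with ⟨h, _⟩ | ⟨h, _⟩ <;> rw [h]
    · linarith [Real.exp_pos (-l * y)]
    · rw [mul_neg, ← neg_mul]; linarith [Real.exp_pos (l * y)]
  calc |y| ^ r ≤ (r / l * Real.exp (l * |y| / r)) ^ r :=
        Real.rpow_le_rpow (abs_nonneg y) h1 (by linarith)
    _ = (r / l) ^ r * Real.exp (l * |y|) := by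
        rw [Real.mul_rpow (by positivity) (by positivity), ← Real.exp_mul]
        congr 2
        field_simp
    _ ≤ _ := by gcongr

lemma abs_rpow_sub_rpow_le {a b s : ℝ} (ha : 0 ≤ a) (hb : 0 < b) (hs : 0 ≤ s) (hs1 : s ≤ 1) :
    |a ^ s - b ^ s| ≤ b ^ (s - 1) * |a - b| := by
  have key : ∀ t : ℝ, 0 ≤ t → |t ^ s - 1| ≤ |t - 1| := by
    intro t ht
    rcases le_total 1 t with h | h
    · have h1 := Real.one_le_rpow h hs
      have h2 := Real.rpow_le_rpow_of_exponent_le h hs1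
      rw [Real.rpow_one] at h2
      rw [abs_of_nonneg (by linarith), abs_of_nonneg (by linarith)]
      linarith
    · have h1 := Real.rpow_le_one ht h hs
      have h2 := Real.rpow_le_rpow_of_exponent_ge' ht h hs hs1
      rw [Real.rpow_one] at h2
      rw [abs_of_nonpos (by linarith), abs_of_nonpos (by linarith)]
      linarith
  have h := key (a / b) (by positivity)
  have h1 : a ^ s - b ^ s = b ^ s * ((a / b) ^ s - 1) := by
    rw [Real.div_rpow ha hb.le]; field_simp
  have h2 : a - b = b * (a / b - 1) := by field_simp
  rw [h1, h2, abs_mul, abs_mul, abs_of_pos hb, abs_of_nonneg (by positivity), ← mul_assoc,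
    ← Real.rpow_add_one hb.ne']
  simpa using mul_le_mul_of_nonneg_left h (by positivity : 0 ≤ b ^ s)

variable {n : ℕ} {p r : ℝ}

lemma integral_abs_lpNm_sub_rpow_le {κ : ℝ} (hκ : 0 < κ) (hκ1 : κ ≤ 1)
    (hκp : κ ≤ gaussMoment p) (hn : 0 < n) (hp : 1 ≤ p) (hp2 : p ≤ 2) (hr : 1 ≤ r)
    (hrn : r ≤ n) :
    ∫ x, |lpNm p x - (n * gaussMoment p) ^ (1 / p)| ^ r ∂stdGauss n ≤
      (16 * Real.exp (4 * Real.exp 2) / κ * ((n : ℝ) ^ (1 / p - 1 / 2) * √r)) ^ r := by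
  have hn0 : (0 : ℝ) < n := by exact_mod_cast hn
  have hr0 : 0 < r := by linarith
  have hp0 : 0 < p := by linarith
  have hμ0 : 0 < gaussMoment p := by linarith
  set M := n * gaussMoment p with hM
  have hM0 : 0 < M := by positivity
  obtain ⟨l, hl⟩ : ∃ l, l = √(r / n) / 8 := ⟨_, rfl⟩
  have hl0 : 0 < l := by rw [hl]; positivity
  have hlsq : n * l ^ 2 = r / 64 := by
    rw [hl, div_pow, Real.sq_sqrt (by positivity)]; field_simp; norm_num
  have hl8 : |l| ≤ 1 / 8 := by
    rw [abs_of_pos hl0, hl]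
    have : √(r / n) ≤ 1 := by
      rw [Real.sqrt_le_iff, one_pow, div_le_one hn0]; exact ⟨zero_le_one, hrn⟩
    linarith
  have hl8' : |-l| ≤ 1 / 8 := by rwa [abs_neg]
  have hrl : r / l = 8 * (√r * √n) := by
    rw [hl, Real.sqrt_div hr0.le]
    have := Real.mul_self_sqrt hr0.le
    have h3 : 0 < √r := Real.sqrt_pos.2 hr0
    have h4 : 0 < √(n : ℝ) := Real.sqrt_pos.2 hn0
    field_simp
    linear_combination -this
  have hpt : ∀ x : Fin n → ℝ, |lpNm p x - M ^ (1 / p)| ^ r ≤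
      (M ^ (1 / p - 1)) ^ r * ((r / l) ^ r * (Real.exp (l * (∑ i, |x i| ^ p - M)) +
        Real.exp (-l * (∑ i, |x i| ^ p - M)))) := by
    intro x
    have h1 := abs_rpow_sub_rpow_le (a := ∑ i, |x i| ^ p) (by positivity) hM0
      (show 0 ≤ 1 / p by positivity) (by rw [div_le_one hp0]; exact hp)
    calc _ ≤ (M ^ (1 / p - 1) * |∑ i, |x i| ^ p - M|) ^ r :=
          Real.rpow_le_rpow (abs_nonneg _) h1 hr0.le
      _ = (M ^ (1 / p - 1)) ^ r * |∑ i, |x i| ^ p - M| ^ r :=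
          Real.mul_rpow (by positivity) (abs_nonneg _)
      _ ≤ _ := by
          gcongr
          exact abs_rpow_le_mul_exp_add_exp hr hl0 _
  have hi1 := integrable_exp_sum_centered n hp hp2 hl8
  have hi2 := integrable_exp_sum_centered n hp hp2 hl8'
  have hb1 := integral_exp_sum_centered_le n hp hp2 hl8
  have hb2 := integral_exp_sum_centered_le n hp hp2 hl8'
  rw [neg_sq, hlsq] at hb2
  rw [hlsq] at hb1
  have hexp : 2 * Real.exp (256 * Real.exp 2 * (r / 64)) ≤
      (2 * Real.exp (4 * Real.exp 2)) ^ r := by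
    rw [Real.mul_rpow (by norm_num) (by positivity), ← Real.exp_mul]
    have h2 : (2 : ℝ) ≤ 2 ^ r := by
      simpa using Real.rpow_le_rpow_of_exponent_le (show (1 : ℝ) ≤ 2 by norm_num) hr
    have h3 : 256 * Real.exp 2 * (r / 64) = 4 * Real.exp 2 * r := by ring
    rw [h3]
    gcongr
  have hMD : M ^ (1 / p - 1) * √n ≤ (n : ℝ) ^ (1 / p - 1 / 2) / κ := by
    rw [hM, Real.mul_rpow hn0.le hμ0.le, Real.sqrt_eq_rpow]
    have h1 : gaussMoment p ^ (1 / p - 1) ≤ κ⁻¹ := by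
      have he : 1 / p - 1 ≤ 0 := by
        rw [sub_nonpos, div_le_one hp0]; exact hp
      refine (Real.rpow_le_rpow_of_nonpos hκ hκp he).trans ?_
      rw [← Real.rpow_neg_one]
      refine Real.rpow_le_rpow_of_exponent_ge hκ hκ1 ?_
      have : 0 < 1 / p := by positivity
      linarith
    calc _ = gaussMoment p ^ (1 / p - 1) * ((n : ℝ) ^ (1 / p - 1) * (n : ℝ) ^ (1 / 2 : ℝ)) := by
          ring
      _ = gaussMoment p ^ (1 / p - 1) * (n : ℝ) ^ (1 / p - 1 / 2) := by
          rw [← Real.rpow_add hn0]; ring_nf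
      _ ≤ κ⁻¹ * (n : ℝ) ^ (1 / p - 1 / 2) := by gcongr
      _ = _ := by ring
  calc ∫ x, |lpNm p x - M ^ (1 / p)| ^ r ∂stdGauss n
      ≤ ∫ x, (M ^ (1 / p - 1)) ^ r * ((r / l) ^ r * (Real.exp (l * (∑ i, |x i| ^ p - M)) +
        Real.exp (-l * (∑ i, |x i| ^ p - M)))) ∂stdGauss n :=
        integral_mono (integrable_abs_lpNm_sub_rpow hn hp hp2 hr _)
          (((hi1.add hi2).const_mul _).const_mul _) hpt
    _ = (M ^ (1 / p - 1)) ^ r * ((r / l) ^ r *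
          (∫ x, Real.exp (l * (∑ i, |x i| ^ p - M)) ∂stdGauss n +
            ∫ x, Real.exp (-l * (∑ i, |x i| ^ p - M)) ∂stdGauss n)) := by
        rw [integral_const_mul, integral_const_mul, integral_add hi1 hi2]
    _ ≤ (M ^ (1 / p - 1)) ^ r * ((r / l) ^ r * (2 * Real.exp (4 * Real.exp 2)) ^ r) := by
        gcongr
        linarith
    _ = (16 * Real.exp (4 * Real.exp 2) * √r * (M ^ (1 / p - 1) * √n)) ^ r := by
        rw [← Real.mul_rpow (by positivity) (by positivity),
          ← Real.mul_rpow (by positivity) (by positivity), hrl]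
        congr 1
        ring
    _ ≤ (16 * Real.exp (4 * Real.exp 2) * √r * ((n : ℝ) ^ (1 / p - 1 / 2) / κ)) ^ r := by
        gcongr
    _ = _ := by congr 1; ring

lemma le_integral_lpNm {κ : ℝ} (hκp : κ ≤ gaussMoment 1) (hn : 0 < n) (hp : 1 ≤ p)
    (hp2 : p ≤ 2) :
    κ * ((n : ℝ) ^ (1 / p - 1 / 2) * √n) ≤ ∫ x, lpNm p x ∂stdGauss n := by
  have hn0 : (0 : ℝ) < n := by exact_mod_cast hn
  have habs : Integrable (fun y : ℝ => |y|) (gaussianReal 0 1) := by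
    simpa using integrable_abs_rpow_gaussianReal le_rfl one_le_two
  have hi : ∀ i : Fin n, Integrable (fun x : Fin n → ℝ => |x i|) (stdGauss n) :=
    fun i => integrable_comp_eval (μ := fun _ : Fin n => gaussianReal 0 1)
      (f := fun y : ℝ => |y|) habs
  have h1 : ∫ x : Fin n → ℝ, (n : ℝ) ^ (1 / p - 1) * ∑ i, |x i| ∂stdGauss n =
      (n : ℝ) ^ (1 / p - 1) * (n * gaussMoment 1) := by
    rw [integral_const_mul, integral_finsetSum _ fun i _ => hi i]
    have h2 : ∀ i : Fin n, ∫ x : Fin n → ℝ, |x i| ∂stdGauss n = gaussMoment 1 := fun i => by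
      rw [integral_comp_eval (μ := fun _ : Fin n => gaussianReal 0 1)
        (f := fun y : ℝ => |y|) habs.aestronglyMeasurable]
      simp [gaussMoment]
    simp [h2]
  calc κ * ((n : ℝ) ^ (1 / p - 1 / 2) * √n)
      ≤ gaussMoment 1 * ((n : ℝ) ^ (1 / p - 1 / 2) * √n) := by gcongr
    _ = (n : ℝ) ^ (1 / p - 1) * (n * gaussMoment 1) := by
        have : (n : ℝ) ^ (1 / p - 1 / 2) * √n = (n : ℝ) ^ (1 / p - 1) * n := by
          rw [Real.sqrt_eq_rpow, ← Real.rpow_add hn0, ← Real.rpow_add_one hn0.ne']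
          ring_nf
        rw [this]; ring
    _ = _ := h1.symm
    _ ≤ _ := integral_mono ((integrable_finsetSum _ fun i _ => hi i).const_mul _)
        (integrable_lpNm hn hp hp2) (le_lpNm hn hp)

/-- Upper bound for the centered moments, with an absolute constant. -/
lemma exists_integral_abs_lpNm_sub_mean_rpow_le :
    ∃ C : ℝ, 0 < C ∧ ∀ (n : ℕ), 0 < n → ∀ p : ℝ, 1 ≤ p → p ≤ 2 →
      0 < ∫ x, lpNm p x ∂stdGauss n ∧ ∀ r : ℝ, 1 ≤ r →
      ∫ x, |lpNm p x - ∫ y, lpNm p y ∂stdGauss n| ^ r ∂stdGauss n ≤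
        (C * √(r / n) * ∫ x, lpNm p x ∂stdGauss n) ^ r := by
  obtain ⟨κ, hκ, hκ1, hκp⟩ := exists_pos_le_gaussMoment
  set K := 16 * Real.exp (4 * Real.exp 2) / κ with hK
  have hK0 : 0 < K := by positivity
  have hK2 : 2 ≤ K := by
    rw [hK, le_div_iff₀ hκ]
    linarith [Real.one_le_exp (show 0 ≤ 4 * Real.exp 2 by positivity)]
  refine ⟨2 * K / κ, by positivity, fun n hn p hp hp2 => ?_⟩
  have hn0 : (0 : ℝ) < n := by exact_mod_cast hn
  have hm := le_integral_lpNm (hκp 1 le_rfl one_le_two) hn hp hp2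
  refine ⟨lt_of_lt_of_le (by positivity) hm, fun r hr => ?_⟩
  set m := ∫ x, lpNm p x ∂stdGauss n
  have hr0 : 0 < r := by linarith
  have hcent : ∃ a : ℝ, ∫ x, |lpNm p x - a| ^ r ∂stdGauss n ≤
      (K * ((n : ℝ) ^ (1 / p - 1 / 2) * √r)) ^ r := by
    rcases le_total r n with h | h
    · exact ⟨_, integral_abs_lpNm_sub_rpow_le hκ hκ1 (hκp p hp hp2) hn hp hp2 hr h⟩
    · refine ⟨0, ?_⟩
      simp only [sub_zero, abs_of_nonneg (lpNm_nonneg _)]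
      refine (integral_lpNm_rpow_le hn hp hp2 hr h).trans ?_
      gcongr
  obtain ⟨a, ha⟩ := hcent
  calc ∫ x, |lpNm p x - m| ^ r ∂stdGauss n
      ≤ 2 ^ r * ∫ x, |lpNm p x - a| ^ r ∂stdGauss n :=
        integral_abs_sub_mean_rpow_le hr a (integrable_lpNm hn hp hp2)
          (integrable_abs_lpNm_sub_rpow hn hp hp2 hr)
    _ ≤ 2 ^ r * (K * ((n : ℝ) ^ (1 / p - 1 / 2) * √r)) ^ r := by gcongr
    _ = (2 * K / κ * √(r / n) * (κ * ((n : ℝ) ^ (1 / p - 1 / 2) * √n))) ^ r := by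
        rw [← Real.mul_rpow (by norm_num) (by positivity), Real.sqrt_div hr0.le]
        have : 0 < √(n : ℝ) := Real.sqrt_pos.2 hn0
        congr 1
        field_simp
    _ ≤ (2 * K / κ * √(r / n) * m) ^ r := by gcongr

end upper

/-- A lower bound for the first absolute moment in terms of the second and the fourth. -/
lemma integral_sq_div_sub_le_integral_abs {Ω : Type*} [MeasurableSpace Ω] {μ : Measure Ω}
    {g : Ω → ℝ} {L : ℝ} (hL : 0 < L) (h1 : Integrable (fun x => |g x|) μ)
    (h2 : Integrable (fun x => |g x| ^ (2 : ℝ)) μ) (h4 : Integrable (fun x => |g x| ^ (4 : ℝ)) μ) :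
    (∫ x, |g x| ^ (2 : ℝ) ∂μ) / L - (∫ x, |g x| ^ (4 : ℝ) ∂μ) / L ^ 3 ≤ ∫ x, |g x| ∂μ := by
  rw [← integral_div, ← integral_div, ← integral_sub (h2.div_const _) (h4.div_const _)]
  refine integral_mono ((h2.div_const _).sub (h4.div_const _)) h1 fun x => ?_
  simp only
  have e4 : |g x| ^ (4 : ℝ) = |g x| ^ 4 := by exact_mod_cast Real.rpow_natCast |g x| 4
  rw [Real.rpow_two, e4]
  obtain ⟨u, hu⟩ : ∃ u, u = |g x| / L := ⟨_, rfl⟩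
  have hu0 : 0 ≤ u := by rw [hu]; positivity
  have hg : |g x| = u * L := by rw [hu]; field_simp
  have hkey : u ^ 2 - u ^ 4 ≤ u := by
    rcases le_total u 1 with h | h
    · nlinarith [pow_nonneg hu0 4]
    · nlinarith [pow_le_pow_right₀ h (show 2 ≤ 4 by norm_num)]
  have : |g x| ^ 2 / L - |g x| ^ 4 / L ^ 3 = L * (u ^ 2 - u ^ 4) := by
    rw [hg]; field_simp
  rw [this, hg, mul_comm u]
  gcongr

lemma integral_abs_le_integral_abs_rpow {Ω : Type*} [MeasurableSpace Ω] {μ : Measure Ω}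
    [IsProbabilityMeasure μ] {g : Ω → ℝ} {r : ℝ} (hr : 1 ≤ r) (h1 : Integrable (fun x => |g x|) μ)
    (h2 : Integrable (fun x => |g x| ^ r) μ) :
    ∫ x, |g x| ∂μ ≤ (∫ x, |g x| ^ r ∂μ) ^ (1 / r) := by
  have h := (convexOn_rpow hr).map_integral_le
      (Real.continuous_rpow_const (by linarith)).continuousOn
      isClosed_Ici (ae_of_all _ fun x => abs_nonneg (g x)) h1 h2
  rw [one_div, Real.le_rpow_inv_iff_of_pos (integral_nonneg fun x => abs_nonneg _)
    (integral_nonneg fun x => by positivity) (by linarith)]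
  exact h

theorem stmt11 :
    ∃ c C : ℝ, 0 < c ∧ 0 < C ∧
      ∀ (n : ℕ), 0 < n → ∀ p : ℝ, 1 ≤ p → p ≤ 2 → ∀ r : ℝ, 1 ≤ r →
        c * Real.sqrt (r / n) *
            (∫ x, (∑ i, |x i| ^ p) ^ (1 / p) ∂(Measure.pi fun _ : Fin n => gaussianReal 0 1)) ≤
          (∫ x, |(∑ i, |x i| ^ p) ^ (1 / p) -
              ∫ y, (∑ i, |y i| ^ p) ^ (1 / p)
                ∂(Measure.pi fun _ : Fin n => gaussianReal 0 1)| ^ r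
            ∂(Measure.pi fun _ : Fin n => gaussianReal 0 1)) ^ (1 / r) ∧
        (∫ x, |(∑ i, |x i| ^ p) ^ (1 / p) -
            ∫ y, (∑ i, |y i| ^ p) ^ (1 / p)
              ∂(Measure.pi fun _ : Fin n => gaussianReal 0 1)| ^ r
          ∂(Measure.pi fun _ : Fin n => gaussianReal 0 1)) ^ (1 / r) ≤
          C * Real.sqrt (r / n) *
            ∫ x, (∑ i, |x i| ^ p) ^ (1 / p) ∂(Measure.pi fun _ : Fin n => gaussianReal 0 1) := by
  obtain ⟨C, hC, hup⟩ := exists_integral_abs_lpNm_sub_mean_rpow_le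
  obtain ⟨b, hb⟩ : ∃ b, b = (Real.exp 1)⁻¹ / 10 := ⟨_, rfl⟩
  have hb0 : 0 < b := by rw [hb]; positivity
  refine ⟨min b (b ^ 3 / (8 * C ^ 2)), C, by positivity, hC, fun n hn p hp hp2 r hr => ?_⟩
  obtain ⟨hm, hup⟩ := hup n hn p hp hp2
  have hlow := fun r hr => le_integral_abs_lpNm_sub_mean_rpow (r := r) hn hp hp2 hr
  rw [← hb] at hlow
  have hint := fun r (hr : 1 ≤ r) => integrable_abs_lpNm_sub_rpow hn hp hp2 hr
    (∫ x, lpNm p x ∂stdGauss n)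
  change min b (b ^ 3 / (8 * C ^ 2)) * √(r / n) * (∫ x, lpNm p x ∂stdGauss n) ≤
    (∫ x, |lpNm p x - ∫ y, lpNm p y ∂stdGauss n| ^ r ∂stdGauss n) ^ (1 / r) ∧
    (∫ x, |lpNm p x - ∫ y, lpNm p y ∂stdGauss n| ^ r ∂stdGauss n) ^ (1 / r) ≤
      C * √(r / n) * ∫ x, lpNm p x ∂stdGauss n
  set m := ∫ x, lpNm p x ∂stdGauss n
  have hn0 : (0 : ℝ) < n := by exact_mod_cast hn
  have hr0 : 0 < r := by linarith
  have hnn : ∀ r : ℝ, 0 ≤ ∫ x, |lpNm p x - m| ^ r ∂stdGauss n :=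
    fun r => integral_nonneg fun x => by positivity
  constructor
  · rcases le_total 2 r with h2 | h2
    · refine le_trans ?_ (hlow r h2)
      gcongr
      exact min_le_left _ _
    · obtain ⟨V, hV⟩ : ∃ V, V = m / √n := ⟨_, rfl⟩
      have hV0 : 0 < V := by rw [hV]; positivity
      have hVr : ∀ q : ℝ, 0 ≤ q → √(q / n) * m = √q * V := fun q hq => by
        rw [hV, Real.sqrt_div hq]; ring
      have hI1 : Integrable (fun x => |lpNm p x - m|) (stdGauss n) := by
        simpa using hint 1 le_rfl
      have hsecond : 2 * (b * V) ^ 2 ≤ ∫ x, |lpNm p x - m| ^ (2 : ℝ) ∂stdGauss n := by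
        have h := hlow 2 le_rfl
        rw [mul_assoc, hVr 2 (by norm_num), ← Real.sqrt_eq_rpow] at h
        have h' := Real.le_sqrt' (by positivity) |>.1 h
        have h3 := Real.sq_sqrt (show (0 : ℝ) ≤ 2 by norm_num)
        calc 2 * (b * V) ^ 2 = (b * (√2 * V)) ^ 2 := by
              rw [mul_pow, mul_pow, mul_pow, h3]; ring
          _ ≤ _ := h'
      have hfourth : ∫ x, |lpNm p x - m| ^ (4 : ℝ) ∂stdGauss n ≤ 16 * (C * V) ^ 4 := by
        have h := hup 4 (by norm_num)
        rw [mul_assoc C, hVr 4 (by norm_num)] at h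
        have h3 : √(4 : ℝ) = 2 := by
          rw [show (4 : ℝ) = 2 ^ 2 by norm_num]; exact Real.sqrt_sq (by norm_num)
        have h4 : (C * (√4 * V)) ^ (4 : ℝ) = 16 * (C * V) ^ 4 := by
          rw [h3, show (4 : ℝ) = ((4 : ℕ) : ℝ) by norm_num, Real.rpow_natCast]; ring
        rwa [h4] at h
      obtain ⟨L, hL⟩ : ∃ L, L = 4 * C ^ 2 / b * V := ⟨_, rfl⟩
      have hL0 : 0 < L := by rw [hL]; positivity
      have hfirst := integral_sq_div_sub_le_integral_abs hL0 hI1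
        (hint 2 (by norm_num)) (hint 4 (by norm_num))
      have hfirst' : b ^ 3 / (4 * C ^ 2) * V ≤ ∫ x, |lpNm p x - m| ∂stdGauss n := by
        calc b ^ 3 / (4 * C ^ 2) * V = 2 * (b * V) ^ 2 / L - 16 * (C * V) ^ 4 / L ^ 3 := by
              rw [hL]; field_simp; ring
          _ ≤ (∫ x, |lpNm p x - m| ^ (2 : ℝ) ∂stdGauss n) / L -
              (∫ x, |lpNm p x - m| ^ (4 : ℝ) ∂stdGauss n) / L ^ 3 := by gcongr
          _ ≤ _ := hfirst
      have hsr : √r ≤ 2 := by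
        rw [Real.sqrt_le_iff]; constructor <;> linarith
      calc min b (b ^ 3 / (8 * C ^ 2)) * √(r / n) * m
          = min b (b ^ 3 / (8 * C ^ 2)) * (√r * V) := by rw [mul_assoc, hVr r hr0.le]
        _ ≤ b ^ 3 / (8 * C ^ 2) * (2 * V) := by
            gcongr
            exact min_le_right _ _
        _ = b ^ 3 / (4 * C ^ 2) * V := by field_simp; norm_num
        _ ≤ ∫ x, |lpNm p x - m| ∂stdGauss n := hfirst'
        _ ≤ _ := integral_abs_le_integral_abs_rpow hr hI1 (hint r hr)
  · rw [one_div, Real.rpow_inv_le_iff_of_pos (hnn r) (by positivity) hr0]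
    exact hup r hr
end

section
/- Let X, Y be independent standard Gaussian vectors in ℝⁿ and 2 < p < ∞. Then for all r ≥ 2, (E|‖X‖_p^p − ‖Y‖_p^p|^r)^{1/r} is bounded above and below by absolute constant multiples of σ_p^p · max{2^{p/2}·(rn)^{1/2}, r^{p/2}·n^{1/r}}, where σ_p^p = E|g|^p for g ~ N(0,1). -/
open MeasureTheory ProbabilityTheory

/-- The exponential tail `∑_{2 ≤ q ≤ r} (r x)^q / q!` completed by a term of order `r`. -/
noncomputable def momentSeries (r x : ℝ) : ℝ :=
  ∑ q ∈ Finset.Icc 2 ⌊r⌋₊, (r * x) ^ q / (q.factorial : ℝ) + 3 ^ r * x ^ r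

lemma sq_div_two_le_exp_sub {x : ℝ} (hx : 0 ≤ x) : x ^ 2 / 2 ≤ Real.exp x - 1 - x := by
  have := Real.quadratic_le_exp_of_nonneg hx
  linarith

lemma exp_sub_le_exp_abs_sub (y : ℝ) : Real.exp y - 1 - y ≤ Real.exp |y| - 1 - |y| := by
  rcases le_total 0 y with h | h
  · rw [abs_of_nonneg h]
  · rw [abs_of_nonpos h]
    have h1 : Real.sinh y ≤ y := Real.sinh_le_self_iff.2 h
    rw [Real.sinh_eq] at h1
    linarith

lemma exp_mul_le_sum_add {r x : ℝ} (hr : 2 ≤ r) (hx0 : 0 ≤ x) (hx1 : x ≤ 1) :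
    Real.exp (r * x) ≤ 1 + r * x + ∑ q ∈ Finset.Icc 2 ⌊r⌋₊, (r * x) ^ q / (q.factorial : ℝ) +
      Real.exp r * x ^ r := by
  have hr0 : 0 ≤ r := by linarith
  have hsplit : ∑ q ∈ Finset.range (⌊r⌋₊ + 1), (r * x) ^ q / (q.factorial : ℝ) =
      1 + r * x + ∑ q ∈ Finset.Icc 2 ⌊r⌋₊, (r * x) ^ q / (q.factorial : ℝ) := by
    have h2 : 2 ≤ ⌊r⌋₊ + 1 := by
      have : 2 ≤ ⌊r⌋₊ := Nat.le_floor (by exact_mod_cast hr)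
      omega
    rw [← Finset.sum_range_add_sum_Ico _ h2]
    simp [Finset.sum_range_succ, Finset.Ico_add_one_right_eq_Icc]
  rw [← hsplit]
  have hlim : Filter.Tendsto (fun M : ℕ => ∑ q ∈ Finset.range M, (r * x) ^ q / (q.factorial : ℝ))
      Filter.atTop (nhds (Real.exp (r * x))) := by
    rw [Real.exp_eq_exp_ℝ]
    exact (NormedSpace.expSeries_div_hasSum_exp (r * x)).tendsto_sum_nat
  refine le_of_tendsto hlim ?_
  filter_upwards [Filter.eventually_ge_atTop (⌊r⌋₊ + 1)] with M hM
  rw [← Finset.sum_range_add_sum_Ico _ hM]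
  gcongr
  calc ∑ q ∈ Finset.Ico (⌊r⌋₊ + 1) M, (r * x) ^ q / (q.factorial : ℝ)
      ≤ ∑ q ∈ Finset.Ico (⌊r⌋₊ + 1) M, r ^ q / (q.factorial : ℝ) * x ^ r := by
        refine Finset.sum_le_sum fun q hq => ?_
        have hq' : r ≤ q := by
          have := (Finset.mem_Ico.1 hq).1
          exact (Nat.lt_floor_add_one r).le.trans (by exact_mod_cast this)
        have hxq : x ^ q ≤ x ^ r := by
          rcases hx0.eq_or_lt with rfl | hx
          · rw [zero_pow (by have := (Finset.mem_Ico.1 hq).1; omega)]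
            positivity
          · rw [← Real.rpow_natCast]
            exact Real.rpow_le_rpow_of_exponent_ge hx hx1 hq'
        rw [mul_pow, mul_div_right_comm]
        gcongr
    _ ≤ ∑ q ∈ Finset.range M, r ^ q / (q.factorial : ℝ) * x ^ r := by
        refine Finset.sum_le_sum_of_subset_of_nonneg ?_ fun _ _ _ => by positivity
        intro q; simp
    _ = (∑ q ∈ Finset.range M, r ^ q / (q.factorial : ℝ)) * x ^ r := by rw [Finset.sum_mul]
    _ ≤ Real.exp r * x ^ r := by
        gcongr
        exact Real.sum_le_exp_of_nonneg hr0 M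

lemma exp_le_three_rpow {r : ℝ} (hr : 0 ≤ r) : Real.exp r ≤ 3 ^ r := by
  rw [← Real.exp_one_rpow]
  exact Real.rpow_le_rpow (Real.exp_pos _).le (by linarith [Real.exp_one_lt_d9]) hr

lemma rpow_one_add_le_momentSeries {r a x w : ℝ} (hr : 2 ≤ r) (ha : |a| ≤ 1) (hw0 : 0 ≤ w)
    (hw : w ≤ x ^ 2) (hpos : 0 ≤ 1 + a * x + w) :
    (1 + a * x + w) ^ (r / 2) ≤ 1 + r / 2 * (a * x) + 2 * momentSeries r |x| := by
  have hr0 : 0 ≤ r := by linarith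
  have hax : |a * x| ≤ |x| := by
    rw [abs_mul]
    exact mul_le_of_le_one_left (abs_nonneg _) ha
  have hS : 0 ≤ ∑ q ∈ Finset.Icc 2 ⌊r⌋₊, (r * |x|) ^ q / (q.factorial : ℝ) :=
    Finset.sum_nonneg fun _ _ => by positivity
  have hexp3 := exp_le_three_rpow hr0
  have hw' : w ≤ |x| ^ 2 := by rwa [sq_abs]
  have hax1 := (abs_le.1 hax).1
  have hax2 := (abs_le.1 hax).2
  rcases le_total |x| 1 with hx | hx
  · set y := r / 2 * (a * x + w) with hy
    have hyabs : |y| ≤ r * |x| := by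
      have : |a * x + w| ≤ 2 * |x| := by
        rw [abs_le]
        constructor <;> nlinarith [abs_nonneg x]
      rw [hy, abs_mul, abs_of_nonneg (by positivity : 0 ≤ r / 2)]
      nlinarith
    have h1 : (1 + a * x + w) ^ (r / 2) ≤ Real.exp y := by
      have : 1 + a * x + w ≤ Real.exp (a * x + w) := by
        linarith [Real.add_one_le_exp (a * x + w)]
      calc _ ≤ Real.exp (a * x + w) ^ (r / 2) := Real.rpow_le_rpow hpos this (by positivity)
        _ = Real.exp y := by rw [← Real.exp_mul, hy, mul_comm]
    have h2 := exp_sub_le_exp_abs_sub y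
    have hmono : Real.exp |y| - 1 - |y| ≤ Real.exp (r * |x|) - 1 - r * |x| := by
      have e1 : Real.exp (r * |x|) = Real.exp |y| * Real.exp (r * |x| - |y|) := by
        rw [← Real.exp_add]; ring_nf
      have e2 := Real.add_one_le_exp (r * |x| - |y|)
      have e3 : 1 ≤ Real.exp |y| := Real.one_le_exp (abs_nonneg _)
      rw [e1]
      nlinarith
    have h3 := exp_mul_le_sum_add hr (abs_nonneg x) hx
    have h4 := sq_div_two_le_exp_sub (by positivity : 0 ≤ r * |x|)
    have h5 : r / 2 * w ≤ (r * |x|) ^ 2 / 2 := by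
      have : 0 ≤ |x| ^ 2 := by positivity
      nlinarith [mul_nonneg hr0 this]
    have h6 : Real.exp r * |x| ^ r ≤ 3 ^ r * |x| ^ r := by gcongr
    rw [momentSeries]
    have : y = r / 2 * (a * x) + r / 2 * w := by rw [hy]; ring
    linarith
  · have hx0 : 0 < |x| := by linarith
    have h1 : (1 + a * x + w) ^ (r / 2) ≤ 3 ^ r * |x| ^ r := by
      calc (1 + a * x + w) ^ (r / 2) ≤ ((3 * |x|) ^ (2 : ℝ)) ^ (r / 2) := by
            refine Real.rpow_le_rpow hpos ?_ (by positivity)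
            rw [Real.rpow_two]
            nlinarith
        _ = (3 * |x|) ^ r := by
            rw [← Real.rpow_mul (by positivity)]; congr 1; ring
        _ = _ := Real.mul_rpow (by norm_num) hx0.le
    have h2 : r / 2 * |x| ≤ 3 ^ r * |x| ^ r := by
      have e1 : |x| ≤ |x| ^ r := by
        conv_lhs => rw [← Real.rpow_one |x|]
        exact Real.rpow_le_rpow_of_exponent_le hx (by linarith)
      have e2 : r / 2 ≤ 3 ^ r := by linarith [Real.add_one_le_exp r]
      gcongr
    have h3 : -(r / 2 * (a * x)) ≤ r / 2 * |x| := by nlinarith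
    rw [momentSeries]
    linarith

lemma one_add_add_sq_rpow_le {r s z : ℝ} (hr : 2 ≤ r) :
    (1 + (s + z) ^ 2) ^ (r / 2) ≤
      (1 + s ^ 2) ^ (r / 2) * (1 + r / 2 * (2 * s / (1 + s ^ 2)) * z + 2 * momentSeries r |z|) := by
  have hA : 0 < 1 + s ^ 2 := by positivity
  have heq : 1 + (s + z) ^ 2 = (1 + s ^ 2) * (1 + 2 * s / (1 + s ^ 2) * z + z ^ 2 / (1 + s ^ 2)) := by
    field_simp
    ring
  have hpos : 0 ≤ 1 + 2 * s / (1 + s ^ 2) * z + z ^ 2 / (1 + s ^ 2) := by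
    by_contra! h
    nlinarith [mul_neg_of_pos_of_neg hA h, sq_nonneg (s + z)]
  rw [heq, Real.mul_rpow hA.le hpos]
  gcongr
  have := rpow_one_add_le_momentSeries (r := r) (a := 2 * s / (1 + s ^ 2)) (x := z)
    (w := z ^ 2 / (1 + s ^ 2)) hr ?_ (by positivity) ?_ hpos
  · linarith
  · rw [abs_div, abs_of_pos hA, div_le_one hA, abs_le]
    constructor <;> nlinarith [sq_nonneg (s - 1), sq_nonneg (s + 1)]
  · exact div_le_self (sq_nonneg z) (by nlinarith)

/-- A parameter-free form of the log-convexity of `q ↦ q ^ q`. -/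
lemma mul_rpow_le_of_endpoints {n p r M q : ℝ} (hn : 0 < n) (hp : 2 ≤ p) (hr : 2 ≤ r)
    (hM1 : 2 ^ (p / 2) * (r * n) ^ ((1 : ℝ) / 2) ≤ M) (hM2 : r ^ (p / 2) * n ^ (1 / r) ≤ M)
    (hq2 : 2 ≤ q) (hqr : q ≤ r) :
    n * (r * q ^ (p / 2 - 1) / M) ^ q ≤ r := by
  have hr0 : 0 < r := by linarith
  have hq0 : 0 < q := by linarith
  have hM : 0 < M := lt_of_lt_of_le (by positivity) hM2
  set f : ℝ → ℝ := fun q => (p / 2 - 1) * (q * Real.log q) + q * (Real.log r - Real.log M) with hf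
  have hlog : ∀ q : ℝ, 0 < q → Real.log (n * (r * q ^ (p / 2 - 1) / M) ^ q) = Real.log n + f q := by
    intro q hq
    rw [Real.log_mul hn.ne' (by positivity), Real.log_rpow (by positivity),
      Real.log_div (by positivity) hM.ne', Real.log_mul hr0.ne' (by positivity),
      Real.log_rpow hq, hf]
    ring
  have hconv : ConvexOn ℝ (Set.Ici (0 : ℝ)) f := by
    refine (Real.convexOn_mul_log.smul (by linarith : 0 ≤ p / 2 - 1)).add ?_
    refine ⟨convex_Ici 0, fun x _ y _ a b _ _ _ => le_of_eq ?_⟩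
    simp only [smul_eq_mul]; ring
  have hmax := hconv.le_max_of_mem_Icc (x := 2) (y := r) (by simp) (by simpa using hr0.le)
    ⟨hq2, hqr⟩
  have hl1 : p / 2 * Real.log 2 + 1 / 2 * (Real.log r + Real.log n) ≤ Real.log M := by
    have := Real.log_le_log (by positivity) hM1
    rwa [Real.log_mul (by positivity) (by positivity), Real.log_rpow (by norm_num),
      Real.log_rpow (by positivity), Real.log_mul hr0.ne' hn.ne'] at this
  have hl2 : p / 2 * Real.log r + 1 / r * Real.log n ≤ Real.log M := by
    have := Real.log_le_log (by positivity) hM2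
    rwa [Real.log_mul (by positivity) (by positivity), Real.log_rpow hr0,
      Real.log_rpow hn] at this
  have hlogr : 0 ≤ Real.log r := Real.log_nonneg (by linarith)
  have hlog2 : 0 ≤ Real.log 2 := Real.log_nonneg (by norm_num)
  have hend : max (f 2) (f r) ≤ Real.log r - Real.log n := by
    refine max_le ?_ ?_
    · simp only [hf]; linarith
    · simp only [hf]
      have := mul_le_mul_of_nonneg_left hl2 hr0.le
      have e : r * (1 / r * Real.log n) = Real.log n := by field_simp
      nlinarith
  rw [← Real.log_le_log_iff (by positivity) hr0, hlog q hq0]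
  linarith

open scoped NNReal

/-- The law of the sum of `n` independent variables of law `ν`. -/
noncomputable def convPow (ν : Measure ℝ) : ℕ → Measure ℝ
  | 0 => Measure.dirac 0
  | n + 1 => Measure.conv (convPow ν n) ν

instance convPow.isProbabilityMeasure (ν : Measure ℝ) [IsProbabilityMeasure ν] (n : ℕ) :
    IsProbabilityMeasure (convPow ν n) := by
  induction n with
  | zero => rw [convPow]; infer_instance
  | succ n ih => rw [convPow]; infer_instance

lemma memLp_id_convPow {ν : Measure ℝ} [IsProbabilityMeasure ν]
    (hν : ∀ q : ℝ≥0, MemLp id q ν) (n : ℕ) (q : ℝ≥0) : MemLp id q (convPow ν n) := by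
  induction n with
  | zero =>
    rw [convPow]
    refine MemLp.of_bound aestronglyMeasurable_id 0 ?_
    rw [ae_dirac_eq]
    simp
  | succ n ih =>
    rw [convPow, Measure.conv,
      memLp_map_measure_iff aestronglyMeasurable_id (by fun_prop)]
    exact (ih.comp_fst ν).add ((hν q).comp_snd (convPow ν n))

lemma map_sum_pi_eq_convPow {α : Type*} [MeasurableSpace α] (μ : Measure α)
    [IsProbabilityMeasure μ] {f : α → ℝ} (hf : Measurable f) (n : ℕ) :
    (Measure.pi fun _ : Fin n => μ).map (fun x => ∑ i, f (x i)) = convPow (μ.map f) n := by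
  have := Measure.isProbabilityMeasure_map (μ := μ) hf.aemeasurable
  induction n with
  | zero =>
    simp [convPow, Measure.map_const]
  | succ n ih =>
    rw [convPow, Measure.conv_comm, ← ih, Measure.conv,
      Measure.map_prod_map _ _ hf (by fun_prop),
      Measure.map_map (by fun_prop) (by fun_prop),
      ← (measurePreserving_piFinSuccAbove (fun _ : Fin (n + 1) => μ) 0).map_eq,
      Measure.map_map (by fun_prop) (by fun_prop)]
    congr 1
    ext x
    simp [Fin.sum_univ_succ, MeasurableEquiv.piFinSuccAbove, Fin.insertNthEquiv, Fin.tail]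

section Convolution

variable {μ ν : Measure ℝ} [IsProbabilityMeasure μ] [IsProbabilityMeasure ν] {f h : ℝ → ℝ}

lemma integral_conv_le (hf : Integrable f (Measure.conv μ ν)) (hh : Integrable h μ)
    (hfh : ∀ s, Integrable (fun z => f (s + z)) ν → ∫ z, f (s + z) ∂ν ≤ h s) :
    ∫ x, f x ∂(Measure.conv μ ν) ≤ ∫ s, h s ∂μ := by
  rw [integral_conv hf]
  have hprod : Integrable (fun x : ℝ × ℝ => f (x.1 + x.2)) (μ.prod ν) :=
    (integrable_map_measure hf.1 (by fun_prop)).1 hf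
  refine integral_mono_ae hprod.integral_prod_left hh ?_
  filter_upwards [hprod.prod_right_ae] with s hs using hfh s hs

lemma le_integral_conv (hf : Integrable f (Measure.conv μ ν)) (hh : Integrable h μ)
    (hfh : ∀ s, Integrable (fun z => f (s + z)) ν → h s ≤ ∫ z, f (s + z) ∂ν) :
    ∫ s, h s ∂μ ≤ ∫ x, f x ∂(Measure.conv μ ν) := by
  have := integral_conv_le hf.neg hh.neg fun s hs => by
    have hs' : Integrable (fun z => f (s + z)) ν := by simpa using hs.neg
    simpa [integral_neg] using hfh s hs'
  simpa [integral_neg] using this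

lemma integrable_abs_rpow (hμ : ∀ q : ℝ≥0, MemLp id q μ) {q : ℝ} (hq : 0 ≤ q) :
    Integrable (fun x => |x| ^ q) μ := by
  lift q to ℝ≥0 using hq
  rcases eq_or_ne q 0 with rfl | h0
  · simp
  · simpa using (hμ q).integrable_norm_rpow (by exact_mod_cast h0) (by simp)

lemma integrable_abs_pow (hμ : ∀ q : ℝ≥0, MemLp id q μ) (q : ℕ) :
    Integrable (fun x => |x| ^ q) μ := by
  simpa using integrable_abs_rpow hμ (Nat.cast_nonneg q)

lemma integrable_one_add_sq_rpow (hμ : ∀ q : ℝ≥0, MemLp id q μ) (t : ℝ) {r : ℝ} (hr : 0 ≤ r) :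
    Integrable (fun x => (1 + (x / t) ^ 2) ^ (r / 2)) μ := by
  have h1 : Integrable (fun x => 2 ^ (r / 2) * (1 + |x| ^ r / |t| ^ r)) μ :=
    ((integrable_const 1).add ((integrable_abs_rpow hμ hr).div_const _)).const_mul _
  refine h1.mono' (Measurable.pow_const (by fun_prop) _).aestronglyMeasurable
    (Filter.Eventually.of_forall fun x => ?_)
  rw [Real.norm_of_nonneg (by positivity), ← Real.div_rpow (abs_nonneg _) (abs_nonneg _),
    ← abs_div]
  set y := x / t
  have hy : (|y| ^ 2) ^ (r / 2) = |y| ^ r := by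
    rw [← Real.rpow_two, ← Real.rpow_mul (abs_nonneg _)]; congr 1; ring
  calc (1 + y ^ 2) ^ (r / 2) ≤ (2 * max 1 (|y| ^ 2)) ^ (r / 2) := by
        refine Real.rpow_le_rpow (by positivity) ?_ (by positivity)
        rw [← sq_abs]
        linarith [le_max_left 1 (|y| ^ 2), le_max_right 1 (|y| ^ 2)]
    _ = 2 ^ (r / 2) * (max 1 (|y| ^ 2)) ^ (r / 2) := Real.mul_rpow (by norm_num) (by positivity)
    _ ≤ 2 ^ (r / 2) * (1 + |y| ^ r) := by
        gcongr
        rcases max_cases 1 (|y| ^ 2) with ⟨h, _⟩ | ⟨h, _⟩ <;> rw [h]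
        · rw [Real.one_rpow]
          linarith [Real.rpow_nonneg (abs_nonneg y) r]
        · rw [hy]; linarith

lemma integrable_momentSeries (hμ : ∀ q : ℝ≥0, MemLp id q μ) (t : ℝ) {r : ℝ} (hr : 0 ≤ r) :
    Integrable (fun x => momentSeries r |x / t|) μ := by
  unfold momentSeries
  refine Integrable.add (integrable_finsetSum _ fun q _ => ?_) ?_
  · refine Integrable.div_const ?_ _
    simp_rw [abs_div, mul_pow, div_pow]
    exact ((integrable_abs_pow hμ q).div_const _).const_mul _
  · simp_rw [abs_div]
    simp_rw [Real.div_rpow (abs_nonneg _) (abs_nonneg _)]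
    exact ((integrable_abs_rpow hμ hr).div_const _).const_mul _

lemma integral_symmetrize {ν : Measure ℝ} {f : ℝ → ℝ} (hsym : ν.map (fun x => -x) = ν) {s : ℝ}
    (hf : Integrable (fun z => f (s + z)) ν) :
    Integrable (fun z => (f (s + z) + f (s - z)) / 2) ν ∧
      ∫ z, f (s + z) ∂ν = ∫ z, (f (s + z) + f (s - z)) / 2 ∂ν := by
  have hmp : MeasurePreserving (fun x : ℝ => -x) ν ν := ⟨measurable_neg, hsym⟩
  have hemb : MeasurableEmbedding (fun x : ℝ => -x) := (MeasurableEquiv.neg ℝ).measurableEmbedding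
  have h1 : Integrable (fun z => f (s - z)) ν := by
    have := (hmp.integrable_comp_emb hemb).2 hf
    simpa [Function.comp_def, sub_eq_add_neg] using this
  have h2 : ∫ z, f (s - z) ∂ν = ∫ z, f (s + z) ∂ν := by
    have := hmp.integral_comp hemb (fun z => f (s + z))
    simpa [sub_eq_add_neg] using this
  refine ⟨(hf.add h1).div_const 2, ?_⟩
  rw [integral_div, integral_add hf h1, h2]
  ring

end Convolution

lemma abs_rpow_add_le_clarkson {r : ℝ} (hr : 2 ≤ r) (s z : ℝ) :
    |s| ^ r + |z| ^ r ≤ (|s + z| ^ r + |s - z| ^ r) / 2 := by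
  have hsq : ∀ x : ℝ, |x| ^ r = (x ^ 2) ^ (r / 2) := fun x => by
    rw [← sq_abs, ← Real.rpow_two, ← Real.rpow_mul (abs_nonneg _)]; congr 1; ring
  simp_rw [hsq]
  have h1 : 1 ≤ r / 2 := by linarith
  have hc := (convexOn_rpow h1).2 (x := (s + z) ^ 2) (y := (s - z) ^ 2)
    (by simp [sq_nonneg]) (by simp [sq_nonneg]) (by norm_num : (0 : ℝ) ≤ 1 / 2)
    (by norm_num : (0 : ℝ) ≤ 1 / 2) (by norm_num)
  have h2 := Real.add_rpow_le_rpow_add (sq_nonneg s) (sq_nonneg z) h1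
  simp only [smul_eq_mul] at hc
  have e : (1 / 2 : ℝ) * (s + z) ^ 2 + 1 / 2 * (s - z) ^ 2 = s ^ 2 + z ^ 2 := by ring
  rw [e] at hc
  linarith

lemma pow_add_pow_sub_ge (s z : ℝ) (k : ℕ) :
    s ^ (2 * k + 2) + (k + 1) * (2 * k + 1) * s ^ (2 * k) * z ^ 2 ≤
        ((s + z) ^ (2 * k + 2) + (s - z) ^ (2 * k + 2)) / 2 ∧
      4 * (k + 1) * s ^ (2 * k + 2) * z ^ 2 ≤
        s * z * ((s + z) ^ (2 * k + 2) - (s - z) ^ (2 * k + 2)) := by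
  induction k with
  | zero =>
    constructor
    · norm_num; nlinarith
    · norm_num; nlinarith
  | succ k ih =>
    obtain ⟨h1, h2⟩ := ih
    have e1 : ∀ x : ℝ, x ^ (2 * (k + 1) + 2) = x ^ (2 * k + 2) * x ^ 2 := fun x => by ring
    have e2 : ∀ x : ℝ, x ^ (2 * (k + 1)) = x ^ (2 * k + 2) := fun x => by ring
    have e3 : s ^ (2 * k + 2) = s ^ (2 * k) * s ^ 2 := by ring
    rw [e1, e1, e1, e2]
    push_cast
    set A := (s + z) ^ (2 * k + 2)
    set B := (s - z) ^ (2 * k + 2)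
    set P := s ^ (2 * k)
    have hP : 0 ≤ P := (even_two_mul k).pow_nonneg s
    rw [e3] at h1 h2 ⊢
    have hk : (0 : ℝ) ≤ k := Nat.cast_nonneg k
    have m1 := mul_le_mul_of_nonneg_left h1 (by positivity : 0 ≤ s ^ 2 + z ^ 2)
    have m2 := mul_le_mul_of_nonneg_left h2 (by positivity : 0 ≤ s ^ 2 + z ^ 2)
    have m3 := mul_le_mul_of_nonneg_left h1 (by positivity : 0 ≤ 4 * s ^ 2 * z ^ 2)
    have t1 : 0 ≤ (k + 1) * (2 * k + 1) * P * z ^ 2 * z ^ 2 := by positivity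
    have t2 : 0 ≤ 4 * s ^ 2 * z ^ 2 * ((k + 1) * (2 * k + 1) * P * z ^ 2) := by positivity
    have t3 : 0 ≤ z ^ 2 * (4 * (k + 1) * (P * s ^ 2) * z ^ 2) := by positivity
    constructor
    · linear_combination m1 + h2 + t1
    · linear_combination m2 + m3 + t2 + t3

section SumMoments

variable {ν : Measure ℝ} [IsProbabilityMeasure ν]

lemma integral_one_add_sq_rpow_convPow_le (hν : ∀ q : ℝ≥0, MemLp id q ν) (hmean : ∫ z, z ∂ν = 0)
    (t : ℝ) {r : ℝ} (hr : 2 ≤ r) (n : ℕ) :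
    ∫ x, (1 + (x / t) ^ 2) ^ (r / 2) ∂(convPow ν n) ≤
      (1 + 2 * ∫ z, momentSeries r |z / t| ∂ν) ^ n := by
  have hr0 : 0 ≤ r := by linarith
  have hE : 0 ≤ ∫ z, momentSeries r |z / t| ∂ν :=
    integral_nonneg fun z => add_nonneg (Finset.sum_nonneg fun _ _ => by positivity) (by positivity)
  induction n with
  | zero => simp [convPow]
  | succ n ih =>
    rw [pow_succ]
    refine le_trans ?_ (mul_le_mul_of_nonneg_right ih (by positivity))
    rw [← integral_mul_const]
    have hint := integrable_one_add_sq_rpow (memLp_id_convPow hν (n + 1)) t hr0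
    rw [convPow] at hint ⊢
    refine integral_conv_le hint
      ((integrable_one_add_sq_rpow (memLp_id_convPow hν n) t hr0).mul_const _) fun s hs => ?_
    set a := r / 2 * (2 * (s / t) / (1 + (s / t) ^ 2)) with ha
    have hz : Integrable (fun z : ℝ => z) ν := by
      have := (hν 1).integrable (by simp)
      exact this
    have hzt : Integrable (fun z : ℝ => 1 + a * (z / t)) ν :=
      (integrable_const 1).add ((hz.div_const t).const_mul a)
    have hser := (integrable_momentSeries hν t hr0).const_mul 2
    have hval : ∫ z, (1 + a * (z / t) + 2 * momentSeries r |z / t|) ∂ν =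
        1 + 2 * ∫ z, momentSeries r |z / t| ∂ν := by
      rw [integral_add hzt hser, integral_add (integrable_const 1) ((hz.div_const t).const_mul a),
        integral_const_mul, integral_const_mul, integral_div, hmean]
      simp
    rw [← hval, ← integral_const_mul]
    refine integral_mono hs ((hzt.add hser).const_mul _) fun z => ?_
    have := one_add_add_sq_rpow_le (r := r) (s := s / t) (z := z / t) hr
    simpa [add_div, ha] using this

lemma mul_integral_abs_rpow_le (hν : ∀ q : ℝ≥0, MemLp id q ν)
    (hsym : ν.map (fun x => -x) = ν) {r : ℝ} (hr : 2 ≤ r) (n : ℕ) :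
    n * ∫ z, |z| ^ r ∂ν ≤ ∫ x, |x| ^ r ∂(convPow ν n) := by
  have hr0 : 0 ≤ r := by linarith
  induction n with
  | zero => simp [convPow, Real.zero_rpow (by linarith : r ≠ 0)]
  | succ n ih =>
    have hint := integrable_abs_rpow (memLp_id_convPow hν (n + 1)) hr0
    have hint0 := integrable_abs_rpow (memLp_id_convPow hν n) hr0
    rw [convPow] at hint ⊢
    calc ((n + 1 : ℕ) : ℝ) * ∫ z, |z| ^ r ∂ν
        ≤ ∫ s, (|s| ^ r + ∫ z, |z| ^ r ∂ν) ∂(convPow ν n) := by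
          rw [integral_add hint0 (integrable_const _)]
          simp only [integral_const, probReal_univ, one_smul]
          push_cast
          linarith
      _ ≤ _ := by
          refine le_integral_conv hint (hint0.add (integrable_const _)) fun s hs => ?_
          obtain ⟨h1, h2⟩ := integral_symmetrize (f := fun x => |x| ^ r) hsym hs
          rw [h2]
          have hc : |s| ^ r + ∫ z, |z| ^ r ∂ν = ∫ z, (|s| ^ r + |z| ^ r) ∂ν := by
            rw [integral_add (integrable_const _) (integrable_abs_rpow hν hr0)]
            simp
          rw [hc]
          exact integral_mono ((integrable_const _).add (integrable_abs_rpow hν hr0)) h1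
            fun z => abs_rpow_add_le_clarkson hr s z

lemma integrable_even_pow {μ : Measure ℝ} [IsProbabilityMeasure μ]
    (hμ : ∀ q : ℝ≥0, MemLp id q μ) (k : ℕ) : Integrable (fun x => x ^ (2 * k)) μ := by
  have := integrable_abs_pow hμ (2 * k)
  simpa only [(even_two_mul k).pow_abs] using this

lemma factorial_mul_choose_le_integral_pow (hν : ∀ q : ℝ≥0, MemLp id q ν)
    (hsym : ν.map (fun x => -x) = ν) (n k : ℕ) :
    ((2 * k).factorial : ℝ) / 2 ^ k * n.choose k * (∫ z, z ^ 2 ∂ν) ^ k ≤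
      ∫ x, x ^ (2 * k) ∂(convPow ν n) := by
  induction n generalizing k with
  | zero =>
    cases k with
    | zero => simp
    | succ k => simp [convPow]
  | succ n ih =>
    cases k with
    | zero => simp
    | succ k =>
      have hint := integrable_even_pow (memLp_id_convPow hν (n + 1)) (k + 1)
      have hint0 := integrable_even_pow (memLp_id_convPow hν n) (k + 1)
      have hint1 := (integrable_even_pow (memLp_id_convPow hν n) k).const_mul
        (((k : ℝ) + 1) * (2 * k + 1))
      have hint2 := hint1.mul_const (∫ z, z ^ 2 ∂ν)
      have hsq : Integrable (fun z => z ^ 2) ν := by simpa using integrable_even_pow hν 1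
      have hv : 0 ≤ ∫ z, z ^ 2 ∂ν := integral_nonneg fun z => sq_nonneg z
      rw [convPow] at hint ⊢
      calc ((2 * (k + 1)).factorial : ℝ) / 2 ^ (k + 1) * (n + 1).choose (k + 1) *
            (∫ z, z ^ 2 ∂ν) ^ (k + 1)
          ≤ ∫ s, (s ^ (2 * (k + 1)) + (k + 1) * (2 * k + 1) * s ^ (2 * k) * ∫ z, z ^ 2 ∂ν)
              ∂(convPow ν n) := by
            rw [integral_add hint0 hint2, integral_mul_const, integral_const_mul]
            have i1 := ih (k + 1)
            have i2 := mul_le_mul_of_nonneg_left (ih k)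
              (by positivity : 0 ≤ ((k : ℝ) + 1) * (2 * k + 1) * ∫ z, z ^ 2 ∂ν)
            have hfac : ((2 * (k + 1)).factorial : ℝ) =
                2 * (k + 1) * (2 * k + 1) * (2 * k).factorial := by
              rw [show 2 * (k + 1) = (2 * k + 1) + 1 by ring, Nat.factorial_succ,
                Nat.factorial_succ]
              push_cast
              ring
            rw [Nat.choose_succ_succ]
            push_cast
            rw [hfac] at i1 ⊢
            refine le_of_eq_of_le ?_ ((add_le_add i1 i2).trans_eq (by ring))
            rw [pow_succ (2 : ℝ), pow_succ (∫ z, z ^ 2 ∂ν)]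
            field_simp
            ring
        _ ≤ _ := by
            refine le_integral_conv hint (hint0.add hint2) fun s hs => ?_
            obtain ⟨h1, h2⟩ := integral_symmetrize (f := fun x => x ^ (2 * (k + 1))) hsym hs
            rw [h2, ← integral_const_mul]
            have hc : s ^ (2 * (k + 1)) +
                ∫ z, (k + 1) * (2 * k + 1) * s ^ (2 * k) * z ^ 2 ∂ν =
                ∫ z, (s ^ (2 * (k + 1)) + (k + 1) * (2 * k + 1) * s ^ (2 * k) * z ^ 2) ∂ν := by
              rw [integral_add (integrable_const _) (hsq.const_mul _)]
              simp
            rw [hc]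
            exact integral_mono ((integrable_const _).add (hsq.const_mul _)) h1
              fun z => (pow_add_pow_sub_ge s z k).1

end SumMoments

section TwoSided

variable {ν : Measure ℝ} [IsProbabilityMeasure ν]

lemma integral_momentSeries_le (hν : ∀ q : ℝ≥0, MemLp id q ν) {L M p r n : ℝ} (hL : 0 < L)
    (hU : ∀ q : ℝ, 2 ≤ q → ∫ z, |z| ^ q ∂ν ≤ (q ^ (p / 2) * L) ^ q)
    (hn : 0 < n) (hp : 2 ≤ p) (hr : 2 ≤ r)
    (hM1 : 2 ^ (p / 2) * (r * n) ^ ((1 : ℝ) / 2) ≤ M) (hM2 : r ^ (p / 2) * n ^ (1 / r) ≤ M) :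
    ∫ z, momentSeries r |z / (6 * L * M)| ∂ν ≤ 3 * (r / n) := by
  have hr0 : 0 < r := by linarith
  have hM : 0 < M := lt_of_lt_of_le (by positivity) hM2
  set t := 6 * L * M with ht
  have ht0 : 0 < t := by positivity
  have hmom : ∀ q : ℝ, 2 ≤ q → ∫ z, |z / t| ^ q ∂ν ≤ (q ^ (p / 2) / (6 * M)) ^ q := by
    intro q hq
    simp_rw [abs_div, Real.div_rpow (abs_nonneg _) (abs_nonneg t)]
    rw [integral_div, abs_of_pos ht0, show q ^ (p / 2) / (6 * M) = q ^ (p / 2) * L / t by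
      rw [ht]; field_simp, Real.div_rpow (by positivity) ht0.le]
    gcongr
    exact hU q hq
  have hend : ∀ q : ℝ, 2 ≤ q → q ≤ r →
      (3 * r / q) ^ q * (q ^ (p / 2) / (6 * M)) ^ q ≤ (1 / 2) ^ q * (r / n) := by
    intro q hq hqr
    have hq0 : 0 < q := by linarith
    have := mul_rpow_le_of_endpoints hn hp hr hM1 hM2 hq hqr
    rw [← Real.mul_rpow (by positivity) (by positivity),
      show 3 * r / q * (q ^ (p / 2) / (6 * M)) = 1 / 2 * (r * q ^ (p / 2 - 1) / M) by
        rw [Real.rpow_sub_one hq0.ne']; field_simp; norm_num,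
      Real.mul_rpow (by norm_num) (by positivity)]
    gcongr
    rw [le_div_iff₀ hn]
    linarith
  have hint : ∀ q : ℕ, Integrable (fun z => (r * |z / t|) ^ q / (q.factorial : ℝ)) ν := by
    intro q
    refine Integrable.div_const ?_ _
    simp_rw [abs_div, mul_pow, div_pow]
    exact ((integrable_abs_pow hν q).div_const _).const_mul _
  have hintr : Integrable (fun z => 3 ^ r * |z / t| ^ r) ν := by
    simp_rw [abs_div, Real.div_rpow (abs_nonneg _) (abs_nonneg t)]
    exact ((integrable_abs_rpow hν hr0.le).div_const _).const_mul _
  unfold momentSeries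
  rw [integral_add (integrable_finsetSum _ fun q _ => hint q) hintr,
    integral_finsetSum _ fun q _ => hint q, integral_const_mul]
  have hterm : ∀ q ∈ Finset.Icc 2 ⌊r⌋₊,
      ∫ z, (r * |z / t|) ^ q / (q.factorial : ℝ) ∂ν ≤ (1 / 2) ^ q * (r / n) := by
    intro q hq
    obtain ⟨hq2, hqr⟩ := Finset.mem_Icc.1 hq
    have hq2' : (2 : ℝ) ≤ q := by exact_mod_cast hq2
    have hqr' : (q : ℝ) ≤ r := (Nat.le_floor_iff hr0.le).1 hqr
    have hm := hmom q hq2'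
    have he := hend q hq2' hqr'
    simp only [Real.rpow_natCast] at hm he
    refine le_trans ?_ he
    rw [integral_div]
    simp_rw [mul_pow]
    rw [integral_const_mul, mul_div_right_comm]
    refine mul_le_mul ?_ hm (integral_nonneg fun _ => by positivity) (by positivity)
    have hfac : (q : ℝ) ^ q / q.factorial ≤ 3 ^ q := by
      refine (Real.pow_div_factorial_le_exp _ q.cast_nonneg q).trans ?_
      simpa using exp_le_three_rpow q.cast_nonneg
    have hq0 : 0 < (q : ℝ) := by linarith
    rw [div_le_iff₀ (by positivity)] at hfac
    rw [div_pow, mul_pow, div_le_div_iff₀ (by positivity) (by positivity)]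
    nlinarith [pow_pos hr0 q]
  have hsum : ∑ q ∈ Finset.Icc 2 ⌊r⌋₊, ((1 : ℝ) / 2) ^ q ≤ 2 :=
    (summable_geometric_two.sum_le_tsum _ fun _ _ => by positivity).trans tsum_geometric_two.le
  have hlast : 3 ^ r * ∫ z, |z / t| ^ r ∂ν ≤ 1 * (r / n) := by
    have he := hend r hr le_rfl
    rw [mul_div_cancel_right₀ _ hr0.ne'] at he
    refine (mul_le_mul_of_nonneg_left (hmom r hr) (by positivity)).trans (he.trans ?_)
    gcongr
    exact Real.rpow_le_one (by norm_num) (by norm_num) hr0.le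
  calc _ ≤ ∑ q ∈ Finset.Icc 2 ⌊r⌋₊, (1 / 2) ^ q * (r / n) + 1 * (r / n) :=
        add_le_add (Finset.sum_le_sum hterm) hlast
    _ ≤ 2 * (r / n) + 1 * (r / n) := by
        rw [← Finset.sum_mul]
        gcongr
    _ = _ := by ring

/-- Upper moment bound for sums of independent centred variables whose moments grow like
those of a variable with tail `exp (-t ^ (2 / p))`. -/
theorem integral_rpow_convPow_le (hν : ∀ q : ℝ≥0, MemLp id q ν) (hmean : ∫ z, z ∂ν = 0)
    {L p r : ℝ} (hL : 0 < L)
    (hU : ∀ q : ℝ, 2 ≤ q → ∫ z, |z| ^ q ∂ν ≤ (q ^ (p / 2) * L) ^ q)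
    {n : ℕ} (hn : 0 < n) (hp : 2 ≤ p) (hr : 2 ≤ r) :
    (∫ x, |x| ^ r ∂(convPow ν n)) ^ (1 / r) ≤ 6 * Real.exp 6 * L *
      max (2 ^ (p / 2) * (r * n) ^ ((1 : ℝ) / 2)) (r ^ (p / 2) * (n : ℝ) ^ (1 / r)) := by
  have hr0 : 0 < r := by linarith
  have hn' : (0 : ℝ) < n := by exact_mod_cast hn
  set M := max (2 ^ (p / 2) * (r * n) ^ ((1 : ℝ) / 2)) (r ^ (p / 2) * (n : ℝ) ^ (1 / r))
  have hM1 : 2 ^ (p / 2) * (r * n) ^ ((1 : ℝ) / 2) ≤ M := le_max_left _ _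
  have hM2 : r ^ (p / 2) * (n : ℝ) ^ (1 / r) ≤ M := le_max_right _ _
  have hM : 0 < M := lt_of_lt_of_le (by positivity) hM2
  have hE := integral_momentSeries_le hν hL hU hn' hp hr hM1 hM2
  have hΦ := integral_one_add_sq_rpow_convPow_le hν hmean (6 * L * M) hr n
  set t := 6 * L * M with ht
  have ht0 : 0 < t := by positivity
  have hE0 : 0 ≤ ∫ z, momentSeries r |z / t| ∂ν :=
    integral_nonneg fun z => add_nonneg (Finset.sum_nonneg fun _ _ => by positivity) (by positivity)
  have hexp : (1 + 2 * ∫ z, momentSeries r |z / t| ∂ν) ^ n ≤ Real.exp 6 ^ r := by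
    calc _ ≤ (Real.exp (6 * (r / n))) ^ n := by
          gcongr
          linarith [Real.add_one_le_exp (6 * (r / n))]
      _ = Real.exp 6 ^ r := by
          rw [← Real.exp_nat_mul, ← Real.exp_mul]
          congr 1
          field_simp
  have hle : ∫ x, |x| ^ r ∂(convPow ν n) ≤ (t * Real.exp 6) ^ r := by
    calc ∫ x, |x| ^ r ∂(convPow ν n)
        ≤ ∫ x, t ^ r * (1 + (x / t) ^ 2) ^ (r / 2) ∂(convPow ν n) := by
          refine integral_mono (integrable_abs_rpow (memLp_id_convPow hν n) hr0.le)
            ((integrable_one_add_sq_rpow (memLp_id_convPow hν n) t hr0.le).const_mul _) fun x => ?_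
          have e : |x| ^ r = t ^ r * ((x / t) ^ 2) ^ (r / 2) := by
            rw [← sq_abs, ← Real.rpow_two, ← Real.rpow_mul (abs_nonneg _),
              show 2 * (r / 2) = r by ring, ← Real.mul_rpow ht0.le (abs_nonneg _), abs_div,
              abs_of_pos ht0, mul_div_cancel₀ _ ht0.ne']
          simp only
          rw [e]
          gcongr
          linarith
      _ ≤ (t * Real.exp 6) ^ r := by
          rw [integral_const_mul, Real.mul_rpow ht0.le (Real.exp_pos _).le]
          gcongr
          exact hΦ.trans hexp
  calc _ ≤ ((t * Real.exp 6) ^ r) ^ (1 / r) :=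
        Real.rpow_le_rpow (integral_nonneg fun _ => by positivity) hle (by positivity)
    _ = t * Real.exp 6 := by
        rw [one_div, Real.rpow_rpow_inv (by positivity) hr0.ne']
    _ = _ := by rw [ht]; ring

lemma sqrt_mul_sq_le_integral_rpow (hν : ∀ q : ℝ≥0, MemLp id q ν)
    (hsym : ν.map (fun x => -x) = ν) {r : ℝ} (hr : 2 ≤ r) {n : ℕ} (hrn : r ≤ n) :
    (n * r / 16 * ∫ z, z ^ 2 ∂ν) ^ ((1 : ℝ) / 2) ≤ (∫ x, |x| ^ r ∂(convPow ν n)) ^ (1 / r) := by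
  have hr0 : 0 < r := by linarith
  have hv : 0 ≤ ∫ z, z ^ 2 ∂ν := integral_nonneg fun z => sq_nonneg z
  set v := ∫ z, z ^ 2 ∂ν
  set k := ⌊r / 2⌋₊
  have hk1 : 1 ≤ k := Nat.le_floor (by norm_num; linarith)
  have hk1' : (1 : ℝ) ≤ k := by exact_mod_cast hk1
  have hk2 : (k : ℝ) ≤ r / 2 := Nat.floor_le (by positivity)
  have hk3 : r / 2 < k + 1 := Nat.lt_floor_add_one _
  have h2kn : 2 * k ≤ n := by
    have : (2 : ℝ) * k ≤ n := by linarith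
    exact_mod_cast this
  have hk0 : (0 : ℝ) < k := by linarith
  have hchoose : (n * k / 4 : ℝ) ^ k ≤ ((2 * k).factorial : ℝ) / 2 ^ k * n.choose k := by
    have h1 : (k.factorial : ℝ) * k ^ k ≤ (2 * k).factorial := by
      have := Nat.factorial_mul_pow_le_factorial (m := k) (n := k)
      rw [← two_mul] at this
      refine le_trans ?_ (by exact_mod_cast this : (k.factorial : ℝ) * (k + 1) ^ k ≤ _)
      gcongr
      linarith
    have h2 : ((n : ℝ) / 2) ^ k / k.factorial ≤ n.choose k := by
      refine le_trans ?_ (Nat.pow_le_choose k n)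
      gcongr
      rw [Nat.cast_sub (by omega)]
      have : (2 : ℝ) * k ≤ n := by exact_mod_cast h2kn
      push_cast
      linarith
    calc (n * k / 4 : ℝ) ^ k = (k.factorial * k ^ k) / 2 ^ k * (((n : ℝ) / 2) ^ k / k.factorial) := by
          rw [show (n * k / 4 : ℝ) = k / 2 * (n / 2) by ring, mul_pow, div_pow]
          field_simp
      _ ≤ _ := by gcongr
  have hev : ∀ x : ℝ, x ^ (2 * k) = |x| ^ (2 * k) := fun x => ((even_two_mul k).pow_abs x).symm
  have hpow : (n * k / 4 * v) ^ k ≤ ∫ x, |x| ^ (2 * k) ∂(convPow ν n) := by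
    simp_rw [← hev]
    rw [mul_pow]
    exact (mul_le_mul_of_nonneg_right hchoose (by positivity)).trans
      (factorial_mul_choose_le_integral_pow hν hsym n k)
  have hj : 1 ≤ r / (2 * k) := by rw [one_le_div (by positivity)]; linarith
  have heq : ∀ x : ℝ, (|x| ^ (2 * k)) ^ (r / (2 * k)) = |x| ^ r := fun x => by
    rw [← Real.rpow_natCast, ← Real.rpow_mul (abs_nonneg _)]
    congr 1
    push_cast
    field_simp
  have hjensen : (∫ x, |x| ^ (2 * k) ∂(convPow ν n)) ^ (r / (2 * k)) ≤
      ∫ x, |x| ^ r ∂(convPow ν n) := by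
    have := (convexOn_rpow hj).map_integral_le (μ := convPow ν n) (f := fun x => |x| ^ (2 * k))
      (Real.continuous_rpow_const (by positivity)).continuousOn isClosed_Ici
      (Filter.Eventually.of_forall fun x => by simp)
      (integrable_abs_pow (memLp_id_convPow hν n) _)
      (by
        simp only [Function.comp_def, heq]
        exact integrable_abs_rpow (memLp_id_convPow hν n) hr0.le)
    simpa only [heq] using this
  have hnk : 0 ≤ n * k / 4 * v := by positivity
  have hfin : (n * k / 4 * v) ^ (r / 2) ≤ ∫ x, |x| ^ r ∂(convPow ν n) := by
    refine le_trans (le_of_eq ?_)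
      ((Real.rpow_le_rpow (by positivity) hpow (by positivity)).trans hjensen)
    rw [← Real.rpow_natCast, ← Real.rpow_mul hnk]
    congr 1
    field_simp
  calc (n * r / 16 * v) ^ ((1 : ℝ) / 2) ≤ (n * k / 4 * v) ^ ((1 : ℝ) / 2) := by
        refine Real.rpow_le_rpow (by positivity) ?_ (by norm_num)
        have : r / 4 ≤ k := by
          rcases le_total r 4 with h | h <;> linarith
        have h2 : (n : ℝ) * r / 16 ≤ n * k / 4 := by nlinarith [n.cast_nonneg (α := ℝ)]
        gcongr
    _ = ((n * k / 4 * v) ^ (r / 2)) ^ (1 / r) := by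
        rw [← Real.rpow_mul hnk]
        congr 1
        field_simp
    _ ≤ _ := Real.rpow_le_rpow (by positivity) hfin (by positivity)

/-- Lower moment bound for sums of independent symmetric variables whose moments grow like
those of a variable with tail `exp (-t ^ (2 / p))`. -/
theorem le_integral_rpow_convPow (hν : ∀ q : ℝ≥0, MemLp id q ν)
    (hsym : ν.map (fun x => -x) = ν) {l p r : ℝ} (hl : 0 < l)
    (hLow : ∀ q : ℝ, 2 ≤ q → (q ^ (p / 2) * l) ^ q ≤ ∫ z, |z| ^ q ∂ν)
    {n : ℕ} (hn : 0 < n) (hp : 2 ≤ p) (hr : 2 ≤ r) :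
    l / 4 * max (2 ^ (p / 2) * (r * n) ^ ((1 : ℝ) / 2)) (r ^ (p / 2) * (n : ℝ) ^ (1 / r)) ≤
      (∫ x, |x| ^ r ∂(convPow ν n)) ^ (1 / r) := by
  have hr0 : 0 < r := by linarith
  have hn' : (1 : ℝ) ≤ n := by exact_mod_cast hn
  have h2 : l * (r ^ (p / 2) * (n : ℝ) ^ (1 / r)) ≤ (∫ x, |x| ^ r ∂(convPow ν n)) ^ (1 / r) := by
    have := (mul_le_mul_of_nonneg_left (hLow r hr) (by positivity : (0 : ℝ) ≤ n)).trans
      (mul_integral_abs_rpow_le hν hsym hr n)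
    refine le_trans (le_of_eq ?_) (Real.rpow_le_rpow (by positivity) this (by positivity))
    rw [Real.mul_rpow (by positivity) (by positivity), one_div,
      Real.rpow_rpow_inv (by positivity) hr0.ne']
    ring
  have hpos : 0 ≤ r ^ (p / 2) * (n : ℝ) ^ (1 / r) := by positivity
  rw [mul_max_of_nonneg _ _ (by positivity)]
  refine max_le ?_ (by nlinarith)
  rcases le_total r n with hrn | hrn
  · refine le_trans ?_ (sqrt_mul_sq_le_integral_rpow hν hsym hr hrn)
    have hv : (2 ^ (p / 2) * l) ^ 2 ≤ ∫ z, z ^ 2 ∂ν := by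
      have := hLow 2 le_rfl
      simpa only [Real.rpow_two, sq_abs] using this
    calc l / 4 * (2 ^ (p / 2) * (r * n) ^ ((1 : ℝ) / 2))
        = (n * r / 16 * (2 ^ (p / 2) * l) ^ 2) ^ ((1 : ℝ) / 2) := by
          rw [show n * r / 16 * (2 ^ (p / 2) * l) ^ 2 = (r * n) * (2 ^ (p / 2) * l / 4) ^ 2 by ring,
            ← Real.sqrt_eq_rpow, ← Real.sqrt_eq_rpow,
            Real.sqrt_mul (by positivity : 0 ≤ r * n) ((2 ^ (p / 2) * l / 4) ^ 2),
            Real.sqrt_sq (by positivity)]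
          ring
      _ ≤ _ := Real.rpow_le_rpow (by positivity) (by gcongr) (by norm_num)
  · have key : 2 ^ (p / 2) * (r * n) ^ ((1 : ℝ) / 2) ≤ 2 * (r ^ (p / 2) * (n : ℝ) ^ (1 / r)) := by
      have e1 : (r * n) ^ ((1 : ℝ) / 2) ≤ r := by
        rw [← Real.sqrt_eq_rpow, Real.sqrt_le_iff]
        exact ⟨hr0.le, by nlinarith⟩
      have e2 : r / 2 ≤ (r / 2) ^ (p / 2) := by
        conv_lhs => rw [← Real.rpow_one (r / 2)]
        exact Real.rpow_le_rpow_of_exponent_le (by linarith) (by linarith)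
      rw [Real.div_rpow hr0.le (by norm_num), le_div_iff₀ (by positivity)] at e2
      have e3 : 1 ≤ (n : ℝ) ^ (1 / r) := Real.one_le_rpow hn' (by positivity)
      have e4 : (0 : ℝ) < 2 ^ (p / 2) := by positivity
      have e5 : 0 < r ^ (p / 2) := by positivity
      nlinarith [mul_le_mul_of_nonneg_left e1 e4.le, mul_le_mul_of_nonneg_left e3 e5.le]
    nlinarith

end TwoSided

section Gaussian

lemma integral_abs_rpow_gaussianReal_le {q : ℝ} (hq : 0 < q) :
    ∫ x, |x| ^ q ∂(gaussianReal 0 1) ≤ 2 * (q / Real.exp 1) ^ (q / 2) := by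
  have hsq : 0 < √q := Real.sqrt_pos.2 hq
  have hqq : √q ^ 2 = q := Real.sq_sqrt hq.le
  have hsqrt : √q ^ q = q ^ (q / 2) := by
    rw [Real.sqrt_eq_rpow, ← Real.rpow_mul hq.le]; congr 1; ring
  have hmgf : ∀ t : ℝ, ∫ x, Real.exp (t * x) ∂(gaussianReal 0 1) = Real.exp (t ^ 2 / 2) := by
    intro t
    have := congrFun (mgf_fun_id_gaussianReal (μ := 0) (v := 1)) t
    simpa [mgf] using this
  have hpt : ∀ x : ℝ, |x| ^ q ≤
      q ^ (q / 2) * Real.exp (-q) * (Real.exp (√q * x) + Real.exp (-√q * x)) := by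
    intro x
    have h1 : |x| / √q ≤ Real.exp (|x| / √q - 1) := by
      linarith [Real.add_one_le_exp (|x| / √q - 1)]
    have h2 : |x| ^ q ≤ q ^ (q / 2) * Real.exp (-q) * Real.exp (√q * |x|) := by
      calc |x| ^ q = √q ^ q * (|x| / √q) ^ q := by
            rw [← Real.mul_rpow hsq.le (by positivity), mul_div_cancel₀ _ hsq.ne']
        _ ≤ √q ^ q * (Real.exp (|x| / √q - 1)) ^ q := by gcongr
        _ = _ := by
            rw [hsqrt, ← Real.exp_mul, mul_assoc, ← Real.exp_add]
            congr 2
            field_simp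
            linear_combination (-|x|) * hqq
    refine h2.trans ?_
    gcongr
    rcases abs_cases x with ⟨h, _⟩ | ⟨h, _⟩ <;> rw [h]
    · linarith [Real.exp_pos (-√q * x)]
    · rw [mul_neg, ← neg_mul]
      linarith [Real.exp_pos (√q * x)]
  have hi : ∀ t : ℝ, Integrable (fun x => Real.exp (t * x)) (gaussianReal 0 1) :=
    fun t => integrable_exp_mul_gaussianReal t
  calc ∫ x, |x| ^ q ∂(gaussianReal 0 1)
      ≤ ∫ x, q ^ (q / 2) * Real.exp (-q) * (Real.exp (√q * x) + Real.exp (-√q * x))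
          ∂(gaussianReal 0 1) :=
        integral_mono (integrable_abs_rpow (memLp_id_gaussianReal ·) hq.le)
          (((hi _).add (hi _)).const_mul _) hpt
    _ = 2 * (q / Real.exp 1) ^ (q / 2) := by
        rw [integral_const_mul, integral_add (hi _) (hi _), hmgf, hmgf, neg_sq, hqq,
          Real.div_rpow hq.le (Real.exp_pos _).le, Real.exp_one_rpow,
          div_eq_mul_inv _ (Real.exp (q / 2)), ← Real.exp_neg (q / 2)]
        have : Real.exp (-q) * Real.exp (q / 2) = Real.exp (-(q / 2)) := by
          rw [← Real.exp_add]; congr 1; ring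
        linear_combination (2 * q ^ (q / 2)) * this

/-- The constant in the lower bound for Gaussian moments. -/
noncomputable def gaussianMomentConst : ℝ := (√(2 * Real.pi))⁻¹ * Real.exp (-1)

lemma gaussianMomentConst_pos : 0 < gaussianMomentConst := by
  unfold gaussianMomentConst
  positivity

lemma gaussianMomentConst_le_one : gaussianMomentConst ≤ 1 := by
  unfold gaussianMomentConst
  refine mul_le_one₀ (inv_le_one_of_one_le₀ ?_) (Real.exp_pos _).le (by simp)
  rw [Real.one_le_sqrt]
  linarith [Real.pi_gt_three]

lemma le_integral_indicator_gaussianReal {f : ℝ → ℝ} (hf : Continuous f) {a c : ℝ}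
    (h : ∀ x ∈ Set.Icc a (a + 1), c ≤ Real.exp (-x ^ 2 / 2) * f x) :
    (√(2 * Real.pi))⁻¹ * c ≤ ∫ x, (Set.Icc a (a + 1)).indicator f x ∂(gaussianReal 0 1) := by
  rw [integral_gaussianReal_eq_integral_smul one_ne_zero]
  have hpdf : ∀ x, gaussianPDFReal 0 1 x = (√(2 * Real.pi))⁻¹ * Real.exp (-x ^ 2 / 2) := fun x => by
    simp [gaussianPDFReal]
  have hEq : (fun x => gaussianPDFReal 0 1 x • (Set.Icc a (a + 1)).indicator f x) =
      (Set.Icc a (a + 1)).indicator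
        (fun x => (√(2 * Real.pi))⁻¹ * (Real.exp (-x ^ 2 / 2) * f x)) := by
    ext x
    by_cases hx : x ∈ Set.Icc a (a + 1)
    · simp [hx, hpdf, mul_assoc]
    · simp [hx]
  rw [hEq, integral_indicator measurableSet_Icc]
  have hint : IntegrableOn (fun x => (√(2 * Real.pi))⁻¹ * (Real.exp (-x ^ 2 / 2) * f x))
      (Set.Icc a (a + 1)) := by
    refine ContinuousOn.integrableOn_Icc (Continuous.continuousOn ?_)
    fun_prop
  calc (√(2 * Real.pi))⁻¹ * c = ∫ _ in Set.Icc a (a + 1), (√(2 * Real.pi))⁻¹ * c := by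
        simp
    _ ≤ _ := by
        refine setIntegral_mono_on continuous_const.integrableOn_Icc hint measurableSet_Icc fun x hx => ?_
        gcongr
        exact h x hx

lemma le_integral_indicator_rpow_gaussianReal {q : ℝ} (hq : 0 < q) :
    gaussianMomentConst * (q / Real.exp 1) ^ (q / 2) ≤
      ∫ x, (Set.Icc (√q) (√q + 1)).indicator (fun x => |x| ^ q) x ∂(gaussianReal 0 1) := by
  have hsq : 0 < √q := Real.sqrt_pos.2 hq
  have hqq : √q ^ 2 = q := Real.sq_sqrt hq.le
  have hsqrt : √q ^ q = q ^ (q / 2) := by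
    rw [Real.sqrt_eq_rpow, ← Real.rpow_mul hq.le]; congr 1; ring
  unfold gaussianMomentConst
  rw [mul_assoc]
  refine le_integral_indicator_gaussianReal
    (continuous_abs.rpow_const fun _ => Or.inr hq.le) fun x hx => ?_
  obtain ⟨u, rfl⟩ : ∃ u, x = √q + u := ⟨x - √q, by ring⟩
  have hu0 : 0 ≤ u := by linarith [hx.1]
  have hu1 : u ≤ 1 := by linarith [hx.2]
  have hv : 0 ≤ u / √q := by positivity
  set v := u / √q with hvdef
  have huv : u = √q * v := by rw [hvdef]; field_simp
  have hlog : v - v ^ 2 / 2 ≤ Real.log (1 + v) := by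
    refine le_trans ?_ (Real.le_log_one_add_of_nonneg hv)
    rw [le_div_iff₀ (by positivity)]
    nlinarith [pow_nonneg hv 3]
  have h1v : Real.exp (q * (v - v ^ 2 / 2)) ≤ (1 + v) ^ q := by
    rw [Real.rpow_def_of_pos (by positivity), mul_comm]
    gcongr
  rw [abs_of_nonneg (by positivity), Real.div_rpow hq.le (Real.exp_pos _).le, Real.exp_one_rpow]
  have hx' : √q + u = √q * (1 + v) := by rw [huv]; ring
  have hpow : (√q + u) ^ q = q ^ (q / 2) * (1 + v) ^ q := by
    rw [hx', Real.mul_rpow hsq.le (by positivity), hsqrt]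
  rw [hpow]
  have hu2 : q * v ^ 2 = u ^ 2 := by rw [huv, mul_pow, hqq]
  have hexp : Real.exp (-1) / Real.exp (q / 2) ≤
      Real.exp (-(√q + u) ^ 2 / 2) * Real.exp (q * (v - v ^ 2 / 2)) := by
    rw [← Real.exp_sub, ← Real.exp_add]
    gcongr
    have e : (√q + u) ^ 2 = q * (1 + v) ^ 2 := by rw [hx', mul_pow, hqq]
    rw [e]
    nlinarith
  calc Real.exp (-1) * (q ^ (q / 2) / Real.exp (q / 2))
      = q ^ (q / 2) * (Real.exp (-1) / Real.exp (q / 2)) := by ring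
    _ ≤ q ^ (q / 2) * (Real.exp (-(√q + u) ^ 2 / 2) * (1 + v) ^ q) := by
        refine mul_le_mul_of_nonneg_left (hexp.trans ?_) (by positivity)
        gcongr
    _ = _ := by ring

lemma le_integral_abs_rpow_gaussianReal {q : ℝ} (hq : 0 < q) :
    gaussianMomentConst * (q / Real.exp 1) ^ (q / 2) ≤ ∫ x, |x| ^ q ∂(gaussianReal 0 1) := by
  refine (le_integral_indicator_rpow_gaussianReal hq).trans ?_
  have hint := integrable_abs_rpow (μ := gaussianReal 0 1) (memLp_id_gaussianReal ·) hq.le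
  exact integral_mono (hint.indicator measurableSet_Icc) hint
    fun x => Set.indicator_le_self' (fun _ _ => by positivity) x

/-- The law of `|g| ^ p - |g'| ^ p` for independent standard Gaussian `g`, `g'`. -/
noncomputable def gaussianPowerDiff (p : ℝ) : Measure ℝ :=
  ((gaussianReal 0 1).prod (gaussianReal 0 1)).map fun z => |z.1| ^ p - |z.2| ^ p

instance gaussianPowerDiff.isProbabilityMeasure (p : ℝ) :
    IsProbabilityMeasure (gaussianPowerDiff p) :=
  Measure.isProbabilityMeasure_map (by fun_prop)

lemma memLp_abs_rpow_gaussianReal {p : ℝ} (hp : 0 < p) (q : ℝ≥0) :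
    MemLp (fun x : ℝ => |x| ^ p) q (gaussianReal 0 1) := by
  lift p to ℝ≥0 using hp.le
  have hp' : (p : ENNReal) ≠ 0 := by exact_mod_cast hp.ne'
  have := (memLp_id_gaussianReal (μ := 0) (v := 1) (q * p)).norm_rpow_div p
  rw [ENNReal.coe_mul, ENNReal.mul_div_cancel_right hp' (by simp)] at this
  simpa using this

lemma memLp_id_gaussianPowerDiff {p : ℝ} (hp : 0 < p) (q : ℝ≥0) :
    MemLp id q (gaussianPowerDiff p) := by
  rw [gaussianPowerDiff, memLp_map_measure_iff aestronglyMeasurable_id (by fun_prop)]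
  exact ((memLp_abs_rpow_gaussianReal hp q).comp_fst _).sub
    ((memLp_abs_rpow_gaussianReal hp q).comp_snd _)

lemma map_neg_gaussianPowerDiff (p : ℝ) :
    (gaussianPowerDiff p).map (fun x => -x) = gaussianPowerDiff p := by
  unfold gaussianPowerDiff
  rw [Measure.map_map (by fun_prop) (by fun_prop)]
  conv_rhs => rw [← Measure.prod_swap, Measure.map_map (by fun_prop) (by fun_prop)]
  congr 1
  ext z
  simp

lemma integral_gaussianPowerDiff {p : ℝ} (hp : 0 < p) : ∫ z, z ∂(gaussianPowerDiff p) = 0 := by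
  have hi : Integrable (fun z : ℝ => z) (gaussianPowerDiff p) :=
    (memLp_id_gaussianPowerDiff hp 1).integrable (by simp)
  have := (integral_symmetrize (f := fun z => z) (s := 0) (map_neg_gaussianPowerDiff p)
    (by simpa using hi)).2
  simpa using this

lemma integral_abs_rpow_gaussianPowerDiff (p q : ℝ) :
    ∫ z, |z| ^ q ∂(gaussianPowerDiff p) =
      ∫ z, |(|z.1| ^ p - |z.2| ^ p)| ^ q ∂((gaussianReal 0 1).prod (gaussianReal 0 1)) :=
  integral_map (by fun_prop) (Measurable.pow_const (by fun_prop) _).aestronglyMeasurable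

lemma integrable_abs_rpow_sub_rpow {p q : ℝ} (hp : 0 < p) (hq : 0 ≤ q) :
    Integrable (fun z : ℝ × ℝ => |(|z.1| ^ p - |z.2| ^ p)| ^ q)
      ((gaussianReal 0 1).prod (gaussianReal 0 1)) :=
  (integrable_map_measure (by fun_prop) (by fun_prop)).1
    (integrable_abs_rpow (memLp_id_gaussianPowerDiff hp) hq)

lemma div_exp_rpow_mul {p q : ℝ} (hp : 0 < p) (hq : 0 < q) :
    (p * q / Real.exp 1) ^ (p * q / 2) = (q ^ (p / 2) * (p / Real.exp 1) ^ (p / 2)) ^ q := by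
  rw [← Real.mul_rpow hq.le (by positivity), ← Real.rpow_mul (by positivity)]
  congr 1 <;> ring

lemma integral_abs_rpow_gaussianPowerDiff_le {p q : ℝ} (hp : 0 < p) (hq : 2 ≤ q) :
    ∫ z, |z| ^ q ∂(gaussianPowerDiff p) ≤
      (q ^ (p / 2) * (2 * (p / Real.exp 1) ^ (p / 2))) ^ q := by
  have hq0 : 0 < q := by linarith
  set γ := gaussianReal 0 1
  have hi : Integrable (fun x : ℝ => |x| ^ (p * q)) γ :=
    integrable_abs_rpow (memLp_id_gaussianReal ·) (by positivity)
  rw [integral_abs_rpow_gaussianPowerDiff]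
  calc ∫ z, |(|z.1| ^ p - |z.2| ^ p)| ^ q ∂(γ.prod γ)
      ≤ ∫ z, (|z.1| ^ (p * q) + |z.2| ^ (p * q)) ∂(γ.prod γ) := by
        refine integral_mono (integrable_abs_rpow_sub_rpow hp hq0.le)
          ((hi.comp_fst γ).add (hi.comp_snd γ)) fun z => ?_
        simp only
        rw [Real.rpow_mul (abs_nonneg _), Real.rpow_mul (abs_nonneg _)]
        have ha : 0 ≤ |z.1| ^ p := by positivity
        have hb : 0 ≤ |z.2| ^ p := by positivity
        have haq := Real.rpow_nonneg ha q
        have hbq := Real.rpow_nonneg hb q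
        rcases le_total (|z.2| ^ p) (|z.1| ^ p) with h | h
        · rw [abs_of_nonneg (by linarith)]
          have := Real.rpow_le_rpow (by linarith) (by linarith : |z.1| ^ p - |z.2| ^ p ≤ |z.1| ^ p)
            hq0.le
          linarith
        · rw [abs_of_nonpos (by linarith)]
          have := Real.rpow_le_rpow (by linarith)
            (by linarith : -(|z.1| ^ p - |z.2| ^ p) ≤ |z.2| ^ p) hq0.le
          linarith
    _ = 2 * ∫ x, |x| ^ (p * q) ∂γ := by
        have e1 := integral_fun_fst (μ := γ) (ν := γ) fun x : ℝ => |x| ^ (p * q)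
        have e2 := integral_fun_snd (μ := γ) (ν := γ) fun x : ℝ => |x| ^ (p * q)
        simp only [probReal_univ, one_smul] at e1 e2
        rw [integral_add (hi.comp_fst γ) (hi.comp_snd γ), e1, e2]
        ring
    _ ≤ 2 * (2 * (p * q / Real.exp 1) ^ (p * q / 2)) := by
        gcongr
        exact integral_abs_rpow_gaussianReal_le (by positivity)
    _ = 2 ^ (2 : ℝ) * (q ^ (p / 2) * (p / Real.exp 1) ^ (p / 2)) ^ q := by
        rw [div_exp_rpow_mul hp hq0, Real.rpow_two]
        ring
    _ ≤ 2 ^ q * (q ^ (p / 2) * (p / Real.exp 1) ^ (p / 2)) ^ q := by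
        gcongr
        norm_num
    _ = _ := by
        rw [← Real.mul_rpow (by norm_num) (by positivity)]
        congr 1
        ring

lemma le_integral_abs_rpow_gaussianPowerDiff {p q : ℝ} (hp : 2 ≤ p) (hq : 2 ≤ q) :
    (q ^ (p / 2) * (gaussianMomentConst ^ 2 * (3 / 4) * (p / Real.exp 1) ^ (p / 2))) ^ q ≤
      ∫ z, |z| ^ q ∂(gaussianPowerDiff p) := by
  have hp0 : 0 < p := by linarith
  have hq0 : 0 < q := by linarith
  set γ := gaussianReal 0 1
  set c := gaussianMomentConst with hc
  have hc0 : 0 < c := gaussianMomentConst_pos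
  set I := (Set.Icc (√(p * q)) (√(p * q) + 1)).indicator (fun x : ℝ => |x| ^ (p * q)) with hI
  set J := (Set.Icc (0 : ℝ) (0 + 1)).indicator (fun _ : ℝ => (1 : ℝ)) with hJ
  have hIint : c * (p * q / Real.exp 1) ^ (p * q / 2) ≤ ∫ x, I x ∂γ :=
    le_integral_indicator_rpow_gaussianReal (by positivity)
  have hJint : c ≤ ∫ x, J x ∂γ := by
    refine le_integral_indicator_gaussianReal continuous_const fun x hx => ?_
    rw [mul_one]
    gcongr
    nlinarith [hx.1, hx.2]
  have hIi : Integrable I γ :=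
    (integrable_abs_rpow (memLp_id_gaussianReal ·) (by positivity)).indicator measurableSet_Icc
  have hJi : Integrable J γ := (integrable_const 1).indicator measurableSet_Icc
  have hpt : ∀ z : ℝ × ℝ, (3 / 4) ^ q * (I z.1 * J z.2) ≤ |(|z.1| ^ p - |z.2| ^ p)| ^ q := by
    intro z
    by_cases h1 : z.1 ∈ Set.Icc (√(p * q)) (√(p * q) + 1)
    swap
    · simp only [hI, Set.indicator_of_notMem h1, zero_mul, mul_zero]
      positivity
    by_cases h2 : z.2 ∈ Set.Icc (0 : ℝ) (0 + 1)
    swap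
    · simp only [hJ, Set.indicator_of_notMem h2, mul_zero]
      positivity
    simp only [hI, hJ, Set.indicator_of_mem h1, Set.indicator_of_mem h2, mul_one]
    have hz1 : 2 ≤ |z.1| := by
      have : 2 ≤ √(p * q) := Real.le_sqrt_of_sq_le (by nlinarith)
      exact (this.trans h1.1).trans (le_abs_self _)
    have hz2 : |z.2| ≤ 1 := abs_le.2 ⟨by linarith [h2.1], by linarith [h2.2]⟩
    have e1 : 4 ≤ |z.1| ^ p := by
      calc (4 : ℝ) = 2 ^ (2 : ℝ) := by norm_num
        _ ≤ 2 ^ p := Real.rpow_le_rpow_of_exponent_le (by norm_num) hp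
        _ ≤ |z.1| ^ p := Real.rpow_le_rpow (by norm_num) hz1 hp0.le
    have e2 : |z.2| ^ p ≤ 1 := Real.rpow_le_one (abs_nonneg _) hz2 hp0.le
    rw [Real.rpow_mul (abs_nonneg _), ← Real.mul_rpow (by norm_num) (by positivity)]
    refine Real.rpow_le_rpow (by positivity) ?_ hq0.le
    refine le_trans ?_ (le_abs_self _)
    linarith
  rw [integral_abs_rpow_gaussianPowerDiff]
  calc _ = (c ^ 2 * (3 / 4)) ^ q * (p * q / Real.exp 1) ^ (p * q / 2) := by
        rw [div_exp_rpow_mul hp0 hq0, ← Real.mul_rpow (by positivity) (by positivity)]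
        congr 1
        ring
    _ ≤ (c ^ 2 * (3 / 4) ^ q) * (p * q / Real.exp 1) ^ (p * q / 2) := by
        rw [Real.mul_rpow (by positivity) (by norm_num)]
        gcongr
        conv_rhs => rw [← Real.rpow_one (c ^ 2)]
        exact Real.rpow_le_rpow_of_exponent_ge (by positivity)
          (pow_le_one₀ hc0.le gaussianMomentConst_le_one) (by linarith)
    _ = (3 / 4) ^ q * ((c * (p * q / Real.exp 1) ^ (p * q / 2)) * c) := by ring
    _ ≤ (3 / 4) ^ q * ((∫ x, I x ∂γ) * ∫ x, J x ∂γ) := by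
        have : 0 ≤ ∫ x, I x ∂γ := le_trans (by positivity) hIint
        gcongr
    _ = ∫ z, (3 / 4) ^ q * (I z.1 * J z.2) ∂(γ.prod γ) := by
        rw [integral_const_mul, integral_prod_mul]
    _ ≤ _ := integral_mono ((hIi.mul_prod hJi).const_mul _)
        (integrable_abs_rpow_sub_rpow hp0 hq0.le) hpt

lemma integral_prod_pi_gaussian_eq (n : ℕ) (p r : ℝ) :
    ∫ z, |(∑ i, |z.1 i| ^ p) - ∑ i, |z.2 i| ^ p| ^ r
        ∂((Measure.pi fun _ : Fin n => gaussianReal 0 1).prod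
          (Measure.pi fun _ : Fin n => gaussianReal 0 1)) =
      ∫ x, |x| ^ r ∂(convPow (gaussianPowerDiff p) n) := by
  rw [gaussianPowerDiff, ← map_sum_pi_eq_convPow _ (by fun_prop),
    integral_map (by fun_prop) (Measurable.pow_const (by fun_prop) _).aestronglyMeasurable]
  have hmp := measurePreserving_arrowProdEquivProdArrow ℝ ℝ (Fin n)
    (fun _ => gaussianReal 0 1) (fun _ => gaussianReal 0 1)
  rw [← hmp.integral_comp (MeasurableEquiv.measurableEmbedding _)]
  simp [MeasurableEquiv.arrowProdEquivProdArrow, Equiv.arrowProdEquivProdArrow,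
    Finset.sum_sub_distrib]

end Gaussian

theorem stmt13 :
    ∃ c C : ℝ, 0 < c ∧ 0 < C ∧
      ∀ (n : ℕ), 0 < n → ∀ p : ℝ, 2 < p → ∀ r : ℝ, 2 ≤ r →
        c * (∫ x : ℝ, |x| ^ p ∂(gaussianReal 0 1)) *
            max (2 ^ (p / 2) * (r * n) ^ ((1:ℝ) / 2)) (r ^ (p / 2) * (n : ℝ) ^ (1 / r)) ≤
          (∫ z, |(∑ i, |z.1 i| ^ p) - ∑ i, |z.2 i| ^ p| ^ r
            ∂((Measure.pi fun _ : Fin n => gaussianReal 0 1).prod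
                (Measure.pi fun _ : Fin n => gaussianReal 0 1))) ^ (1 / r) ∧
        (∫ z, |(∑ i, |z.1 i| ^ p) - ∑ i, |z.2 i| ^ p| ^ r
            ∂((Measure.pi fun _ : Fin n => gaussianReal 0 1).prod
                (Measure.pi fun _ : Fin n => gaussianReal 0 1))) ^ (1 / r) ≤
          C * (∫ x : ℝ, |x| ^ p ∂(gaussianReal 0 1)) *
            max (2 ^ (p / 2) * (r * n) ^ ((1:ℝ) / 2)) (r ^ (p / 2) * (n : ℝ) ^ (1 / r)) := by
  have hk := gaussianMomentConst_pos
  refine ⟨gaussianMomentConst ^ 2 * (3 / 32), 12 * Real.exp 6 / gaussianMomentConst,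
    by positivity, by positivity, fun n hn p hp r hr => ?_⟩
  have hp0 : 0 < p := by linarith
  set B := (p / Real.exp 1) ^ (p / 2) with hB
  have hB0 : 0 < B := by positivity
  have hσ1 : gaussianMomentConst * B ≤ ∫ x : ℝ, |x| ^ p ∂(gaussianReal 0 1) :=
    le_integral_abs_rpow_gaussianReal hp0
  have hσ2 : ∫ x : ℝ, |x| ^ p ∂(gaussianReal 0 1) ≤ 2 * B :=
    integral_abs_rpow_gaussianReal_le hp0
  rw [integral_prod_pi_gaussian_eq]
  constructor
  · refine le_trans ?_ (le_integral_rpow_convPow (memLp_id_gaussianPowerDiff hp0)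
      (map_neg_gaussianPowerDiff p) (l := gaussianMomentConst ^ 2 * (3 / 4) * B) (by positivity)
      (fun q hq => le_integral_abs_rpow_gaussianPowerDiff hp.le hq) hn hp.le hr)
    gcongr
    have := mul_le_mul_of_nonneg_left hσ2
      (by positivity : 0 ≤ gaussianMomentConst ^ 2 * (3 / 32))
    linarith
  · refine (integral_rpow_convPow_le (memLp_id_gaussianPowerDiff hp0)
      (integral_gaussianPowerDiff hp0) (L := 2 * B) (by positivity)
      (fun q hq => integral_abs_rpow_gaussianPowerDiff_le hp0 hq) hn hp.le hr).trans ?_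
    refine mul_le_mul_of_nonneg_right ?_ (le_max_of_le_left (by positivity))
    calc 6 * Real.exp 6 * (2 * B)
        = 12 * Real.exp 6 / gaussianMomentConst * (gaussianMomentConst * B) := by
          field_simp
          norm_num
      _ ≤ _ := mul_le_mul_of_nonneg_left hσ1 (by positivity)
end
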